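/- Let q be a power of 3 and fix η with 3/7 < η < 1. Then there exists D such that for every monic f ∈ F_q[T] with deg f ≥ D, there exist g, h ∈ F_q[T] with |g| ≤ |f|^η and |h| ≤ |f|^η such that μ(f + g) = 1 and μ(f + h) = −1. -/

import Mathlib

open scoped Classical
open Polynomial Filter

/-- The norm `|f| = q ^ deg f` of a polynomial over `F_q`, with `|0| = 0`. -/
noncomputable def pnorm {Fq : Type} [Field Fq] [Fintype Fq] (f : Polynomial Fq) : ℝ :=
  if f = 0 then 0 else (Fintype.card Fq : ℝ) ^ f.natDegree

/-- The Möbius function of a polynomial: `0` unless `f` is squarefree (in particular `μ 0 = 0`),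
and `(-1)^k` for squarefree `f` with `k` distinct monic irreducible factors. -/
noncomputable def pmu {Fq : Type} [Field Fq] (f : Polynomial Fq) : ℤ :=
  if Squarefree f then (-1 : ℤ) ^ Multiset.card (UniqueFactorizationMonoid.normalizedFactors f)
  else 0



/-! ### Polynomials of bounded degree -/

noncomputable def PL (F : Type*) [Field F] [Fintype F] (m : ℕ) : Finset F[X] :=
  Finset.univ.image (fun c : Fin m → F => ((degreeLTEquiv F m).symm c : F[X]))

lemma mem_PL {F : Type*} [Field F] [Fintype F] {m : ℕ} {p : F[X]} :
    p ∈ PL F m ↔ p.degree < m := by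
  simp only [PL, Finset.mem_image, Finset.mem_univ, true_and]
  constructor
  · rintro ⟨c, rfl⟩
    exact mem_degreeLT.1 ((degreeLTEquiv F m).symm c).2
  · intro h
    exact ⟨degreeLTEquiv F m ⟨p, mem_degreeLT.2 h⟩, by simp⟩

lemma card_PL (F : Type*) [Field F] [Fintype F] (m : ℕ) :
    (PL F m).card = Fintype.card F ^ m := by
  rw [PL, Finset.card_image_of_injective]
  · simp
  · intro a b h
    exact (degreeLTEquiv F m).symm.injective (Subtype.ext h)

lemma PL_sub {F : Type*} [Field F] [Fintype F] {m : ℕ} {p q : F[X]} (hp : p ∈ PL F m)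
    (hq : q ∈ PL F m) : p - q ∈ PL F m := by
  rw [mem_PL] at *
  exact lt_of_le_of_lt (degree_sub_le p q) (max_lt hp hq)

lemma PL_add {F : Type*} [Field F] [Fintype F] {m : ℕ} {p q : F[X]} (hp : p ∈ PL F m)
    (hq : q ∈ PL F m) : p + q ∈ PL F m := by
  rw [mem_PL] at *
  exact lt_of_le_of_lt (degree_add_le p q) (max_lt hp hq)

lemma mem_PL_of_natDegree {F : Type*} [Field F] [Fintype F] {m : ℕ} {p : F[X]}
    (h : p = 0 ∨ p.natDegree < m) : p ∈ PL F m := by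
  rw [mem_PL]
  rcases h with rfl | h
  · simp
  · exact (degree_le_natDegree).trans_lt (by exact_mod_cast h)

lemma natDegree_lt_of_mem_PL {F : Type*} [Field F] [Fintype F] {m : ℕ} {p : F[X]}
    (h : p ∈ PL F m) (hp : p ≠ 0) : p.natDegree < m :=
  (natDegree_lt_iff_degree_lt hp).2 (mem_PL.1 h)

/-! ### Stepanov's method -/

lemma coeff_block {K : Type*} [Field K] (J R γ : ℕ) (hγ : γ ≤ R) (b : ℕ → K[X])
    (hb : ∀ j, (b j).degree < γ) (n : ℕ) (hR : 0 < R) :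
    (∑ j ∈ Finset.range J, b j * X ^ (j * R)).coeff n =
      if n / R < J then (b (n / R)).coeff (n % R) else 0 := by
  rw [finsetSum_coeff]
  have key : ∀ j, (b j * X ^ (j * R)).coeff n =
      if j = n / R then (b (n / R)).coeff (n % R) else 0 := by
    intro j
    rw [coeff_mul_X_pow']
    by_cases hj : j = n / R
    · subst hj
      have h1 : n / R * R ≤ n := Nat.div_mul_le_self n R
      have h2 : n - n / R * R = n % R := by
        have := Nat.div_add_mod n R
        rw [mul_comm] at this; omega
      simp [h1, h2]
    · rw [if_neg hj]
      split_ifs with h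
      · apply coeff_eq_zero_of_degree_lt
        refine (hb j).trans_le ?_
        have : R ≤ n - j * R := by
          have h3 : j ≤ n / R := (Nat.le_div_iff_mul_le hR).2 h
          have h4 : j + 1 ≤ n / R := by omega
          have h5 := (Nat.le_div_iff_mul_le hR).1 h4
          have : (j+1)*R = j*R+R := by ring
          omega
        exact_mod_cast hγ.trans this
      · rfl
  simp_rw [key]
  rw [Finset.sum_ite_eq']
  simp

lemma block_natDegree {K : Type*} [Field K] (J R γ : ℕ) (hγ : γ ≤ R) (b : ℕ → K[X])
    (hb : ∀ j, (b j).degree < γ) (hR : 0 < R)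
    (h0 : (∑ j ∈ Finset.range J, b j * X ^ (j * R)) ≠ 0) :
    (∑ j ∈ Finset.range J, b j * X ^ (j * R)).natDegree % R < γ := by
  by_contra hcon
  have h1 := coeff_block J R γ hγ b hb (∑ j ∈ Finset.range J, b j * X ^ (j * R)).natDegree hR
  have h2 : (∑ j ∈ Finset.range J, b j * X ^ (j * R)).coeff
    (∑ j ∈ Finset.range J, b j * X ^ (j * R)).natDegree ≠ 0 := by
      simpa using h0
  rw [h1] at h2
  apply h2
  split_ifs
  · apply coeff_eq_zero_of_degree_lt
    exact (hb _).trans_le (by exact_mod_cast not_lt.1 hcon)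
  · rfl

lemma block_eq_zero {K : Type*} [Field K] (J R γ : ℕ) (hγ : γ ≤ R) (b : ℕ → K[X])
    (hb : ∀ j, (b j).degree < γ) (hR : 0 < R)
    (h0 : (∑ j ∈ Finset.range J, b j * X ^ (j * R)) = 0) : ∀ j < J, b j = 0 := by
  intro j hj
  ext i
  by_cases hi : i < R
  · have h1 := coeff_block J R γ hγ b hb (i + j * R) hR
    rw [h0, Nat.add_mul_div_right _ _ hR, Nat.div_eq_of_lt hi, Nat.add_mul_mod_self_right,
      Nat.mod_eq_of_lt hi] at h1
    simpa [hj] using h1.symm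
  · simp only [coeff_zero]
    apply coeff_eq_zero_of_degree_lt
    exact (hb _).trans_le (by exact_mod_cast hγ.trans (not_lt.1 hi))

lemma stepanov_nonzero {K : Type*} [Field K] (f : K[X]) (D α R' σ J : ℕ) (hD : f.natDegree = D)
    (hodd : Odd D) (hR' : R' = D + 2 * α) (hσ : R' = 2 * σ + 1) (a c : ℕ → K[X])
    (hα : 0 < α)
    (ha : ∀ j, (a j).degree < α) (hc : ∀ j, (c j).degree < (α + D : ℕ))
    (h0 : ∑ j ∈ Finset.range J, (a j + c j * f ^ σ) * X ^ (j * R') = 0) :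
    ∀ j < J, a j = 0 ∧ c j = 0 := by
  have hR0 : 0 < R' := by omega
  have hα' : α ≤ R' := by omega
  have hγ : α + D ≤ R' := by omega
  have hf0 : f ≠ 0 := by
    rintro rfl
    simp at hD; subst hD; simp at hodd
  set U := ∑ j ∈ Finset.range J, a j * X ^ (j * R') with hU
  set W := ∑ j ∈ Finset.range J, c j * X ^ (j * R') with hW
  have hUW : U + f ^ σ * W = 0 := by
    rw [← h0, hU, hW, Finset.mul_sum, ← Finset.sum_add_distrib]
    apply Finset.sum_congr rfl
    intros; ring
  have hW0 : W = 0 := by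
    by_contra hW0
    have hU0 : U ≠ 0 := by
      intro h
      rw [h, zero_add] at hUW
      exact (mul_ne_zero (pow_ne_zero _ hf0) hW0) hUW
    have hdeg : U.natDegree = σ * D + W.natDegree := by
      have : U = -(f ^ σ * W) := by linear_combination hUW
      rw [this, natDegree_neg, natDegree_mul (pow_ne_zero _ hf0) hW0, natDegree_pow, hD]
    have h1 := block_natDegree J R' α hα' a ha hR0 hU0
    have h2 := block_natDegree J R' (α + D) hγ c hc hR0 hW0
    rw [← hU] at h1
    rw [← hW] at h2
    have h3 := Nat.div_add_mod U.natDegree R'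
    have h4 := Nat.div_add_mod W.natDegree R'
    set i := U.natDegree % R'
    set i' := W.natDegree % R'
    set j := U.natDegree / R'
    set j' := W.natDegree / R'
    have h5 : (2 * i + D - 2 * i' : ℤ) = R' * (D + 2 * j' - 2 * j) := by
      have e1 : (R' : ℤ) * j + i = σ * D + (R' * j' + i') := by
        rw [← h3, ← h4] at hdeg; exact_mod_cast hdeg
      have e2 : (R' : ℤ) = 2 * σ + 1 := by exact_mod_cast hσ
      linear_combination 2 * e1 - (D:ℤ) * e2
    obtain ⟨D', rfl⟩ := hodd
    have hy : ((2 * D' + 1 : ℕ) + 2 * j' - 2 * j : ℤ) ≠ 0 := by omega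
    set y : ℤ := ((2 * D' + 1 : ℕ) + 2 * j' - 2 * j : ℤ)
    rcases lt_or_gt_of_ne hy with hy | hy
    · have : (R' : ℤ) * y ≤ - R' := by nlinarith
      rw [← h5] at this
      omega
    · have : (R' : ℤ) ≤ R' * y := by nlinarith
      rw [← h5] at this
      omega
  have hU0 : U = 0 := by rw [hW0] at hUW; simpa using hUW
  intro j hj
  exact ⟨block_eq_zero J R' α hα' a ha hR0 hU0 j hj, block_eq_zero J R' _ hγ c hc hR0 hW0 j hj⟩


lemma stepanov_aux {K : Type*} [Field K] [Fintype K] [CharP K 3] (μ ν : ℕ)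
    (hQ : Fintype.card K = 3 ^ (μ + ν)) (hμν : μ ≤ ν) (f : K[X]) (hodd : Odd f.natDegree)
    (hD : f.natDegree < 3 ^ ν) (ε : K) (hε : ε ≠ 0) :
    ∃ k : K[X], k ≠ 0 ∧ 2 * k.natDegree ≤ 3 ^ (μ + ν) + 2 * (f.natDegree + 1) * 3 ^ ν ∧
      ∀ x : K, f.eval x ^ ((3 ^ (μ + ν) - 1) / 2) = ε → k.eval x = 0 := by
  have : Fact (Nat.Prime 3) := ⟨by norm_num⟩
  obtain ⟨ρ, hρ⟩ : Odd (3 ^ μ) := Odd.pow (by decide)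
  obtain ⟨σ, hσ⟩ : Odd (3 ^ ν) := Odd.pow (by decide)
  set D := f.natDegree with hDdef
  obtain ⟨D', hD'⟩ := id hodd
  set R := 3 ^ μ with hR
  set R' := 3 ^ ν with hR'
  have hRR : R ≤ R' := Nat.pow_le_pow_right (by norm_num) hμν
  have hQ' : (3 : ℕ) ^ (μ + ν) = R * R' := pow_add _ _ _
  rw [hQ'] at hQ ⊢
  obtain ⟨α, hα⟩ : ∃ α, R' = D + 2 * α := ⟨σ - D', by omega⟩
  have hα0 : 0 < α := by omega
  set J := ρ + D' + 2 with hJ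
  set M := R * (α + D) + J with hM
  -- the tuples
  let S : Finset ((Fin J → K[X]) × (Fin J → K[X])) :=
    (Fintype.piFinset fun _ => PL K α) ×ˢ (Fintype.piFinset fun _ => PL K (α + D))
  let Θ : ((Fin J → K[X]) × (Fin J → K[X])) → K[X] := fun t =>
    ∑ j : Fin J, (t.1 j ^ R * f ^ ρ + C ε * t.2 j ^ R) * X ^ (j : ℕ)
  have hmap : ∀ t ∈ S, Θ t ∈ PL K (M - R) := by
    rintro ⟨a, c⟩ ht
    simp only [S, Finset.mem_product, Fintype.mem_piFinset] at ht
    have hle : ∀ j : Fin J, ((a j ^ R * f ^ ρ + C ε * c j ^ R) * X ^ (j : ℕ)) ∈ PL K (M - R) := by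
      intro j
      have hMR : R + (J + R * (α + D - 1)) = M := by
        obtain ⟨z, hz⟩ : ∃ z, α + D = z + 1 := ⟨α + D - 1, by omega⟩
        rw [hM, hz]; simp; ring
      rw [add_mul]
      apply PL_add
      · apply mem_PL_of_natDegree
        by_cases h0 : a j = 0
        · left; rw [h0, zero_pow (by omega)]; simp
        right
        have h1 := natDegree_lt_of_mem_PL (ht.1 j) h0
        refine lt_of_le_of_lt natDegree_mul_le ?_
        refine lt_of_le_of_lt (Nat.add_le_add_right natDegree_mul_le _) ?_
        rw [natDegree_pow, natDegree_pow, natDegree_X_pow]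
        have h2 := j.2
        have h3 : R * (a j).natDegree ≤ R * (α - 1) := Nat.mul_le_mul_left _ (by omega)
        have h4 : R * (α - 1) + R * D = R * (α + D - 1) := by
          rw [← mul_add]; congr 1; omega
        have h5 : ρ * D ≤ R * D := Nat.mul_le_mul_right _ (by omega)
        show R * (a j).natDegree + ρ * D + j < _
        omega
      · apply mem_PL_of_natDegree
        by_cases h0 : c j = 0
        · left; rw [h0, zero_pow (by omega)]; simp
        right
        have h1 := natDegree_lt_of_mem_PL (ht.2 j) h0
        refine lt_of_le_of_lt natDegree_mul_le ?_
        refine lt_of_le_of_lt (Nat.add_le_add_right (natDegree_C_mul_le _ _) _) ?_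
        rw [natDegree_pow, natDegree_X_pow]
        have h2 := j.2
        have h3 : R * (c j).natDegree ≤ R * (α + D - 1) := Nat.mul_le_mul_left _ (by omega)
        omega
    show ∑ j : Fin J, _ ∈ _
    rw [mem_PL]
    refine lt_of_le_of_lt (degree_sum_le _ _) ?_
    rw [Finset.sup_lt_iff (by exact WithBot.bot_lt_coe _)]
    intro j _
    exact mem_PL.1 (hle j)
  have hcard : (PL K (M - R)).card < S.card := by
    simp only [S, Finset.card_product, Fintype.card_piFinset, card_PL, Finset.prod_const,
      Finset.card_univ, Fintype.card_fin]
    rw [← pow_mul, ← pow_mul, ← pow_add]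
    apply Nat.pow_lt_pow_right Fintype.one_lt_card
    have e1 : α * J + (α + D) * J = R' * J := by rw [hα]; ring
    rw [e1]
    -- J R' > R (α + D) - R + J
    have e2 : M - R + R = M := Nat.sub_add_cancel (by
      rw [hM]; nlinarith)
    have e3 : M < R' * J + R := by
      rw [hM]
      have : 2 * (R * (α + D) + J) < 2 * (R' * J + R) := by
        have q1 : 2 * (α + D) = R' + D := by omega
        have q2 : 2 * J = R + D + 2 := by omega
        have q3 : 2 * (R * (α + D) + J) = R * (R' + D) + (R + D + 2) := by
          rw [← q1, ← q2]; ring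
        have q4 : 2 * (R' * J + R) = R' * (R + D + 2) + 2 * R := by rw [← q2]; ring
        rw [q3, q4]
        have q5 : R * D ≤ R' * D := Nat.mul_le_mul_right _ hRR
        nlinarith
      omega
    omega
  obtain ⟨t, ht, t', ht', hne, heq⟩ := Finset.exists_ne_map_eq_of_card_lt_of_maps_to hcard hmap
  simp only [S, Finset.mem_product, Fintype.mem_piFinset] at ht ht'
  let a : ℕ → K[X] := fun j => if h : j < J then t.1 ⟨j, h⟩ - t'.1 ⟨j, h⟩ else 0
  let c : ℕ → K[X] := fun j => if h : j < J then t.2 ⟨j, h⟩ - t'.2 ⟨j, h⟩ else 0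
  have ha : ∀ j, a j ∈ PL K α := by
    intro j
    by_cases h : j < J
    · simp only [a, h, dif_pos]; exact PL_sub (ht.1 _) (ht'.1 _)
    · simp only [a, h]; exact mem_PL_of_natDegree (Or.inl rfl)
  have hc : ∀ j, c j ∈ PL K (α + D) := by
    intro j
    by_cases h : j < J
    · simp only [c, h, dif_pos]; exact PL_sub (ht.2 _) (ht'.2 _)
    · simp only [c, h]; exact mem_PL_of_natDegree (Or.inl rfl)
  have hzero : ∑ j ∈ Finset.range J, (a j ^ R * f ^ ρ + C ε * c j ^ R) * X ^ j = 0 := by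
    rw [Finset.sum_range (fun j => (a j ^ R * f ^ ρ + C ε * c j ^ R) * X ^ j)]
    have : ∀ j : Fin J, (a j ^ R * f ^ ρ + C ε * c j ^ R) * X ^ (j : ℕ) =
        (t.1 j ^ R * f ^ ρ + C ε * t.2 j ^ R) * X ^ (j : ℕ) -
        (t'.1 j ^ R * f ^ ρ + C ε * t'.2 j ^ R) * X ^ (j : ℕ) := by
      intro j
      have e1 : a j = t.1 j - t'.1 j := by simp [a]
      have e2 : c j = t.2 j - t'.2 j := by simp [c]
      rw [e1, e2, hR, sub_pow_char_pow, sub_pow_char_pow]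
      ring
    simp_rw [this]
    rw [Finset.sum_sub_distrib]
    exact sub_eq_zero.2 heq
  refine ⟨∑ j ∈ Finset.range J, (a j + c j * f ^ σ) * X ^ (j * R'), ?_, ?_, ?_⟩
  · intro h0
    have := stepanov_nonzero f D α R' σ J rfl hodd hα hσ a c hα0 (fun j => mem_PL.1 (ha j))
      (fun j => mem_PL.1 (hc j)) h0
    apply hne
    refine Prod.ext (funext fun j => ?_) (funext fun j => ?_)
    · have := (this j j.2).1
      simp only [a, j.2, dif_pos] at this
      exact sub_eq_zero.1 this
    · have := (this j j.2).2
      simp only [c, j.2, dif_pos] at this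
      exact sub_eq_zero.1 this
  · have hdeg : (∑ j ∈ Finset.range J, (a j + c j * f ^ σ) * X ^ (j * R')).natDegree ≤
        (α + D) + σ * D + (J - 1) * R' := by
      apply natDegree_sum_le_of_forall_le
      intro j hj
      have hj' : j * R' ≤ (J - 1) * R' := Nat.mul_le_mul_right _ (by
        have := Finset.mem_range.1 hj; omega)
      refine natDegree_mul_le.trans ?_
      rw [natDegree_X_pow]
      refine Nat.add_le_add ?_ hj'
      refine (natDegree_add_le _ _).trans (max_le ?_ ?_)
      · by_cases h0 : a j = 0
        · simp [h0]
        · have := natDegree_lt_of_mem_PL (ha j) h0; omega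
      · refine natDegree_mul_le.trans ?_
        rw [natDegree_pow]
        refine Nat.add_le_add ?_ le_rfl
        by_cases h0 : c j = 0
        · simp [h0]
        · have := natDegree_lt_of_mem_PL (hc j) h0; omega
    have hJ1 : 2 * (J - 1) = R + D := by omega
    have e1 : 2 * ((α + D) + σ * D + (J - 1) * R') = R' + D + (2 * σ) * D + (2 * (J - 1)) * R' := by
      rw [hα]; ring
    have e2 : D + 2 * σ * D = R' * D := by rw [hσ]; ring
    rw [hJ1] at e1
    nlinarith
  · intro x hx
    have hfx : f.eval x ≠ 0 := by
      intro h
      rw [h] at hx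
      have : (R * R' - 1) / 2 ≠ 0 := by
        have : 3 ≤ R * R' := by
          have h3 : 3 ≤ R' := by
            by_contra h
            have : ν = 0 := by
              by_contra hν
              exact h (hR' ▸ (Nat.le_self_pow hν 3))
            subst this
            simp at hR'
            omega
          nlinarith
        omega
      rw [zero_pow this] at hx
      exact hε hx.symm
    have hxQ : x ^ (R * R') = x := by rw [← hQ]; exact FiniteField.pow_card x
    have h1 : f.eval x ^ ρ *
        (eval x (∑ j ∈ Finset.range J, (a j + c j * f ^ σ) * X ^ (j * R'))) ^ R = 0 := by
      rw [eval_finsetSum, hR, sum_pow_char_pow, Finset.mul_sum]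
      have h2 := congrArg (eval x) hzero
      rw [eval_finsetSum, eval_zero] at h2
      rw [← h2]
      apply Finset.sum_congr rfl
      intro j _
      simp only [eval_mul, eval_add, eval_pow, eval_X, eval_C]
      rw [mul_pow, add_pow_char_pow, mul_pow, ← hR, ← pow_mul, ← pow_mul]
      have e1 : x ^ (j * R' * R) = x ^ j := by
        rw [show j * R' * R = (R * R') * j by ring, pow_mul, hxQ]
      have e2 : eval x f ^ ρ * eval x f ^ (σ * R) = ε := by
        rw [← pow_add, ← hx]
        congr 1
        have : R * R' - 1 = 2 * (ρ + σ * R) := by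
          have : R * R' = 2 * (σ * R) + R := by rw [hσ]; ring
          omega
        omega
      rw [e1, ← e2]
      ring
    rcases mul_eq_zero.1 h1 with h | h
    · exact absurd h (pow_ne_zero _ hfx)
    · exact pow_eq_zero_iff (by omega) |>.1 h

lemma stepanov_count {K : Type*} [Field K] [Fintype K] [CharP K 3] (μ ν : ℕ)
    (hQ : Fintype.card K = 3 ^ (μ + ν)) (hμν : μ ≤ ν) (f : K[X]) (hodd : Odd f.natDegree)
    (ε : K) (hε : ε ≠ 0) :
    2 * (Finset.univ.filter fun x : K => f.eval x ^ ((3 ^ (μ + ν) - 1) / 2) = ε).card ≤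
      3 ^ (μ + ν) + 2 * (f.natDegree + 1) * 3 ^ ν := by
  by_cases hD : f.natDegree < 3 ^ ν
  · obtain ⟨k, hk, hdeg, hroot⟩ := stepanov_aux μ ν hQ hμν f hodd hD ε hε
    refine le_trans ?_ hdeg
    refine Nat.mul_le_mul_left _ ?_
    refine le_trans ?_ (k.card_roots')
    refine le_trans ?_ (Multiset.toFinset_card_le _)
    apply Finset.card_le_card
    intro x hx
    simp only [Finset.mem_filter, Finset.mem_univ, true_and] at hx
    simp [hk, hroot x hx]
  · have h1 : (Finset.univ.filter fun x : K => f.eval x ^ ((3 ^ (μ + ν) - 1) / 2) = ε).card ≤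
      3 ^ (μ + ν) := by rw [← hQ]; exact Finset.card_le_univ _
    have h2 : 3 ^ (μ + ν) ≤ 3 ^ ν * 3 ^ ν := by
      rw [pow_add]; exact Nat.mul_le_mul_right _ (Nat.pow_le_pow_right (by norm_num) hμν)
    have h3 : 3 ^ ν * 3 ^ ν ≤ f.natDegree * 3 ^ ν := Nat.mul_le_mul_right _ (not_lt.1 hD)
    nlinarith

lemma stepanov_sum {K : Type*} [Field K] [Fintype K] [CharP K 3] (μ ν : ℕ)
    (hQ : Fintype.card K = 3 ^ (μ + ν)) (hμν : μ ≤ ν) (f : K[X]) (hodd : Odd f.natDegree) :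
    |∑ x : K, quadraticChar K (f.eval x)| ≤ (3 * f.natDegree + 2) * 3 ^ ν := by
  have hchar : ringChar K ≠ 2 := by
    rw [ringChar.eq K 3]; norm_num
  have h2 : (3 ^ (μ + ν) - 1) / 2 = Fintype.card K / 2 := by
    rw [hQ]
    obtain ⟨z, hz⟩ : Odd (3 ^ (μ + ν)) := Odd.pow (by decide)
    omega
  have hf0 : f ≠ 0 := by rintro rfl; simp at hodd
  have hp := stepanov_count μ ν hQ hμν f hodd 1 one_ne_zero
  have hm := stepanov_count μ ν hQ hμν f hodd (-1) (neg_ne_zero.2 one_ne_zero)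
  set A := Finset.univ.filter fun x : K => f.eval x ^ ((3 ^ (μ + ν) - 1) / 2) = 1 with hA
  set B := Finset.univ.filter fun x : K => f.eval x ^ ((3 ^ (μ + ν) - 1) / 2) = -1 with hB
  set Z := Finset.univ.filter fun x : K => f.eval x = 0 with hZ
  have hZc : Z.card ≤ f.natDegree := by
    refine le_trans ?_ (f.card_roots')
    refine le_trans ?_ (Multiset.toFinset_card_le _)
    apply Finset.card_le_card
    intro x hx
    simp only [hZ, Finset.mem_filter, Finset.mem_univ, true_and] at hx
    simp [hf0, hx]
  have hpm : (1 : K) ≠ -1 := (Ring.neg_one_ne_one_of_char_ne_two hchar).symm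
  have hch : ∀ x : K, (quadraticChar K (f.eval x) : ℤ) =
      (if x ∈ A then 1 else 0) - (if x ∈ B then 1 else 0) := by
    intro x
    by_cases h0 : f.eval x = 0
    · have hne : Fintype.card K / 2 ≠ 0 := by
        have := Fintype.one_lt_card (α := K); omega
      simp [hA, hB, h0, h2, hne]
    · rw [quadraticChar_eq_pow_of_char_ne_two hchar h0]
      simp only [hA, hB, Finset.mem_filter, Finset.mem_univ, true_and, h2]
      rcases FiniteField.pow_dichotomy hchar h0 with h | h
      · simp [h, hpm]
      · simp [h, hpm.symm]
  have hone : ∀ x : K, (1 : ℤ) = (if x ∈ A then 1 else 0) + (if x ∈ B then 1 else 0) +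
      (if x ∈ Z then 1 else 0) := by
    intro x
    by_cases h0 : f.eval x = 0
    · have hne : Fintype.card K / 2 ≠ 0 := by
        have := Fintype.one_lt_card (α := K); omega
      simp [hA, hB, hZ, h0, h2, hne]
    · simp only [hA, hB, hZ, Finset.mem_filter, Finset.mem_univ, true_and, h2]
      rcases FiniteField.pow_dichotomy hchar h0 with h | h
      · simp [h, hpm, h0]
      · simp [h, hpm.symm, h0]
  have hsum : ∑ x : K, quadraticChar K (f.eval x) = (A.card : ℤ) - B.card := by
    simp_rw [hch]
    rw [Finset.sum_sub_distrib]
    simp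
  have htot : (Fintype.card K : ℤ) = A.card + B.card + Z.card := by
    have : (Fintype.card K : ℤ) = ∑ x : K, (1 : ℤ) := by simp
    rw [this, Finset.sum_congr rfl (fun x _ => hone x), Finset.sum_add_distrib,
      Finset.sum_add_distrib]
    simp
  rw [hsum]
  have hR1 : (1 : ℤ) ≤ 3 ^ ν := one_le_pow₀ (by norm_num)
  have hp' : (2 * A.card : ℤ) ≤ Fintype.card K + 2 * (f.natDegree + 1) * 3 ^ ν := by
    rw [hQ]; exact_mod_cast hp
  have hm' : (2 * B.card : ℤ) ≤ Fintype.card K + 2 * (f.natDegree + 1) * 3 ^ ν := by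
    rw [hQ]; exact_mod_cast hm
  have hZ' : (Z.card : ℤ) ≤ f.natDegree := by exact_mod_cast hZc
  have : (f.natDegree : ℤ) ≤ f.natDegree * 3 ^ ν := by nlinarith
  rw [abs_le]
  constructor <;> nlinarith


lemma shift_sum {K : Type*} [Field K] [Fintype K] [CharP K 3] (a : ℕ)
    (hQ : Fintype.card K = 3 ^ a) (r : ℕ) (β : Fin (2 * r) → K) (v : K)
    (hv : Odd (Finset.univ.filter fun j => β j = v).card) :
    |∑ x : K, ∏ j, quadraticChar K (x + β j)| ≤ (6 * r + 3) * 3 ^ (a - a / 2) := by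
  set f : K[X] := ∏ j ∈ Finset.univ.filter (fun j => β j ≠ v), (C (β j - v) * X + C 1) with hf
  have hdeg : f.natDegree = (Finset.univ.filter fun j => β j ≠ v).card := by
    rw [hf, natDegree_prod]
    · rw [Finset.card_eq_sum_ones]
      apply Finset.sum_congr rfl
      intro j hj
      have : β j - v ≠ 0 := sub_ne_zero.2 (Finset.mem_filter.1 hj).2
      exact natDegree_linear this
    · intro j hj h0
      have : β j - v ≠ 0 := sub_ne_zero.2 (Finset.mem_filter.1 hj).2
      have h1 := natDegree_linear (b := (1 : K)) this
      rw [h0] at h1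
      simp at h1
  have hcard : (Finset.univ.filter fun j => β j = v).card +
      (Finset.univ.filter fun j => β j ≠ v).card = 2 * r := by
    have := Finset.card_filter_add_card_filter_not (s := (Finset.univ : Finset (Fin (2 * r))))
      (fun j => β j = v)
    simpa using this
  have hodd : Odd f.natDegree := by
    rw [hdeg]
    obtain ⟨z, hz⟩ := hv
    exact ⟨r - z - 1, by omega⟩
  have hD : f.natDegree ≤ 2 * r := by omega
  have hst := stepanov_sum (a / 2) (a - a / 2) (by rw [hQ]; congr 1; omega) (by omega) f hodd
  have hsum : ∑ x : K, ∏ j, quadraticChar K (x + β j) =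
      ∑ x : K, quadraticChar K (f.eval x) - 1 := by
    have e1 : ∑ x : K, ∏ j, quadraticChar K (x + β j) =
        ∑ t : K, ∏ j, quadraticChar K (t⁻¹ + (β j - v)) := by
      rw [← Equiv.sum_comp (Equiv.subRight v),
        ← Equiv.sum_comp (Function.Involutive.toPerm (fun t : K => t⁻¹) inv_inv)]
      apply Finset.sum_congr rfl
      intro x _
      apply Finset.prod_congr rfl
      intro j _
      congr 1
      show x⁻¹ - v + β j = x⁻¹ + (β j - v)
      ring
    have e2 : ∀ t : K, ∏ j, quadraticChar K (t⁻¹ + (β j - v)) =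
        quadraticChar K (f.eval t) - if t = 0 then 1 else 0 := by
      intro t
      have hfe : quadraticChar K (f.eval t) =
          ∏ j, quadraticChar K ((β j - v) * t + 1) := by
        rw [hf, eval_prod, map_prod, Finset.prod_filter]
        apply Finset.prod_congr rfl
        intro j _
        by_cases h : β j = v
        · simp [h]
        · simp [h]
      by_cases ht : t = 0
      · subst ht
        have h3 : 0 < (Finset.univ.filter fun j => β j = v).card := hv.pos
        obtain ⟨j, hj⟩ := Finset.card_pos.1 h3
        have hj' := (Finset.mem_filter.1 hj).2
        rw [Finset.prod_eq_zero (Finset.mem_univ j) (by simp [hj'])]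
        rw [hfe]; simp
      · rw [hfe, if_neg ht, sub_zero]
        have : ∀ j, quadraticChar K (t⁻¹ + (β j - v)) =
            quadraticChar K t⁻¹ * quadraticChar K ((β j - v) * t + 1) := by
          intro j
          rw [← map_mul]
          congr 1
          field_simp
          ring
        simp_rw [this]
        rw [Finset.prod_mul_distrib, Finset.prod_const, Finset.card_univ, Fintype.card_fin,
          pow_mul, quadraticChar_sq_one (inv_ne_zero ht)]
        simp
    rw [e1, Finset.sum_congr rfl (fun t _ => e2 t), Finset.sum_sub_distrib]
    simp
  rw [hsum]
  have hD' : (f.natDegree : ℤ) ≤ 2 * r := by exact_mod_cast hD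
  have hR1 : (1 : ℤ) ≤ 3 ^ (a - a / 2) := one_le_pow₀ (by norm_num)
  have h5 : (f.natDegree : ℤ) * 3 ^ (a - a / 2) ≤ 2 * r * 3 ^ (a - a / 2) :=
    mul_le_mul_of_nonneg_right hD' (by positivity)
  rw [abs_le] at hst ⊢
  constructor <;> nlinarith [hst.1, hst.2]

lemma even_count {B : Type*} [Fintype B] (r : ℕ) (hr : 0 < r) :
    (Finset.univ.filter fun p : Fin (2 * r) → B =>
      ∀ v, Even (Finset.univ.filter fun j => p j = v).card).card ≤
      r ^ (2 * r) * Fintype.card B ^ r := by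
  have h1 : (Finset.univ.filter fun p : Fin (2 * r) → B =>
      ∀ v, Even (Finset.univ.filter fun j => p j = v).card) ⊆
      (Finset.univ : Finset ((Fin (2 * r) → Fin r) × (Fin r → B))).image
        (fun t => t.2 ∘ t.1) := by
    intro p hp
    simp only [Finset.mem_filter, Finset.mem_univ, true_and] at hp
    have hcard : (Finset.univ.image p).card ≤ r := by
      have h2 := Finset.card_eq_sum_card_image p Finset.univ
      have h3 : ∑ b ∈ Finset.univ.image p, 2 ≤
          ∑ b ∈ Finset.univ.image p, (Finset.univ.filter fun j => p j = b).card := by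
        apply Finset.sum_le_sum
        intro b hb
        obtain ⟨j, _, hj⟩ := Finset.mem_image.1 hb
        have : 0 < (Finset.univ.filter fun j => p j = b).card :=
          Finset.card_pos.2 ⟨j, by simp [hj]⟩
        obtain ⟨z, hz⟩ := hp b
        omega
      rw [← h2] at h3
      simp at h3
      omega
    obtain ⟨e⟩ : Nonempty ((Finset.univ.image p) ↪ Fin r) :=
      Function.Embedding.nonempty_of_card_le (by rw [Fintype.card_coe, Fintype.card_fin]; exact hcard)
    simp only [Finset.mem_image, Finset.mem_univ, true_and]
    refine ⟨(fun j => e ⟨p j, Finset.mem_image_of_mem _ (Finset.mem_univ _)⟩,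
      Function.extend e Subtype.val (fun _ => p ⟨0, by omega⟩)), ?_⟩
    funext j
    simp only [Function.comp]
    rw [e.injective.extend_apply]
  refine (Finset.card_le_card h1).trans (Finset.card_image_le.trans ?_)
  simp

lemma moment_bound {ι : Type} [Fintype ι] (K : ι → Type) [∀ i, Field (K i)] [∀ i, Fintype (K i)]
    [∀ i, CharP (K i) 3] (a : ι → ℕ) (hQ : ∀ i, Fintype.card (K i) = 3 ^ (a i))
    {B : Type} [Fintype B] (e : ∀ i, B → K i) (he : ∀ i, Function.Injective (e i))
    (r : ℕ) (hr : 0 < r) :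
    ∑ z : (∀ i, K i), (∑ b : B, ∏ i, quadraticChar (K i) (z i + e i b)) ^ (2 * r) ≤
      (r : ℤ) ^ (2 * r) * (Fintype.card B) ^ r * ∏ i, (3 : ℤ) ^ (a i) +
      (Fintype.card B) ^ (2 * r) * ∏ i, ((6 * r + 3 : ℤ) * 3 ^ (a i - a i / 2)) := by
  have h1 : ∀ z : (∀ i, K i), (∑ b : B, ∏ i, quadraticChar (K i) (z i + e i b)) ^ (2 * r) =
      ∑ p : Fin (2 * r) → B, ∏ i, ∏ j, quadraticChar (K i) (z i + e i (p j)) := by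
    intro z
    rw [Fintype.sum_pow]
    apply Finset.sum_congr rfl
    intro p _
    rw [Finset.prod_comm]
  simp_rw [h1]
  rw [Finset.sum_comm]
  have h2 : ∀ p : Fin (2 * r) → B,
      ∑ z : (∀ i, K i), ∏ i, ∏ j, quadraticChar (K i) (z i + e i (p j)) =
      ∏ i, ∑ x : K i, ∏ j, quadraticChar (K i) (x + e i (p j)) := by
    intro p
    rw [Finset.prod_univ_sum]
    simp
  simp_rw [h2]
  have hle1 : ∀ (i : ι) (x : K i), |quadraticChar (K i) x| ≤ 1 := by
    intro i x
    rcases quadraticChar_isQuadratic (K i) x with h | h | h <;> rw [h] <;> simp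
  have htriv : ∀ p : Fin (2 * r) → B,
      ∏ i, ∑ x : K i, ∏ j, quadraticChar (K i) (x + e i (p j)) ≤ ∏ i, (3 : ℤ) ^ (a i) := by
    intro p
    refine (le_abs_self _).trans ?_
    rw [Finset.abs_prod]
    apply Finset.prod_le_prod
    · intros; positivity
    · intro i _
      refine (Finset.abs_sum_le_sum_abs _ _).trans ?_
      have : ∀ x : K i, |∏ j, quadraticChar (K i) (x + e i (p j))| ≤ 1 := by
        intro x
        rw [Finset.abs_prod]
        exact Finset.prod_le_one (fun _ _ => abs_nonneg _) (fun _ _ => hle1 _ _)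
      refine (Finset.sum_le_sum (fun x _ => this x)).trans ?_
      simp [hQ]
  have hgood : ∀ p : Fin (2 * r) → B,
      (¬ ∀ v, Even (Finset.univ.filter fun j => p j = v).card) →
      ∏ i, ∑ x : K i, ∏ j, quadraticChar (K i) (x + e i (p j)) ≤
        ∏ i, ((6 * r + 3 : ℤ) * 3 ^ (a i - a i / 2)) := by
    intro p hp
    push Not at hp
    obtain ⟨v, hv⟩ := hp
    rw [Nat.not_even_iff_odd] at hv
    refine (le_abs_self _).trans ?_
    rw [Finset.abs_prod]
    apply Finset.prod_le_prod
    · intros; positivity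
    · intro i _
      apply shift_sum (a i) (hQ i) r (fun j => e i (p j)) (e i v)
      simpa [(he i).eq_iff] using hv
  rw [← Finset.sum_filter_add_sum_filter_not Finset.univ
    (fun p : Fin (2 * r) → B => ∀ v, Even (Finset.univ.filter fun j => p j = v).card)]
  apply add_le_add
  · refine (Finset.sum_le_card_nsmul _ _ _ (fun p _ => htriv p)).trans ?_
    rw [nsmul_eq_mul]
    apply mul_le_mul_of_nonneg_right _ (by positivity)
    exact_mod_cast even_count r hr
  · refine (Finset.sum_le_card_nsmul _ _ _ (fun p hp => hgood p (Finset.mem_filter.1 hp).2)).trans ?_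
    rw [nsmul_eq_mul]
    apply mul_le_mul_of_nonneg_right _ (by positivity)
    have : (Finset.univ.filter fun p : Fin (2 * r) → B =>
      ¬ ∀ v, Even (Finset.univ.filter fun j => p j = v).card).card ≤
        Fintype.card (Fin (2 * r) → B) := Finset.card_le_univ _
    rw [Fintype.card_fun, Fintype.card_fin] at this
    exact_mod_cast this


lemma residue_card {F : Type} [Field F] [Fintype F] {m : ℕ} {S : Finset F[X]} {P : F[X]}
    (hP : P ≠ 0) (hS : ∀ s ∈ S, ∀ t ∈ S, P ∣ s - t ∧ s - t ∈ PL F m) :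
    S.card ≤ Fintype.card F ^ (m - P.natDegree) := by
  rcases S.eq_empty_or_nonempty with rfl | ⟨s0, hs0⟩
  · simp
  rw [← card_PL]
  choose! x hx using fun s (hs : s ∈ S) => (hS s hs s0 hs0).1
  apply Finset.card_le_card_of_injOn x
  · intro s hs
    apply mem_PL_of_natDegree
    by_cases h0 : x s = 0
    · exact Or.inl h0
    · right
      have h1 := (hS s hs s0 hs0).2
      rw [hx s hs] at h1
      have h2 := natDegree_lt_of_mem_PL h1 (mul_ne_zero hP h0)
      rw [natDegree_mul hP h0] at h2
      omega
  · intro s hs t ht h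
    have h1 := hx s hs
    have h2 := hx t ht
    have h : x s = x t := h
    rw [h, ← h2] at h1
    exact sub_left_injective h1

noncomputable def mon {F : Type} [Field F] (k : ℕ) (a : F[X]) : F[X] := X ^ k + a

lemma mon_monic {F : Type} [Field F] [Fintype F] {k : ℕ} {a : F[X]} (h : a ∈ PL F k) :
    (mon k a).Monic := monic_X_pow_add (mem_PL.1 h)

lemma mon_natDegree {F : Type} [Field F] [Fintype F] {k : ℕ} {a : F[X]} (h : a ∈ PL F k) :
    (mon k a).natDegree = k := by
  rw [mon, natDegree_add_eq_left_of_degree_lt, natDegree_X_pow]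
  rw [degree_X_pow]; exact mem_PL.1 h

lemma exists_mon {F : Type} [Field F] [Fintype F] {p : F[X]} (h : p.Monic) :
    ∃ a ∈ PL F p.natDegree, p = mon p.natDegree a := by
  refine ⟨p - X ^ p.natDegree, ?_, by simp [mon]⟩
  rw [mem_PL]
  have : (p - X ^ p.natDegree).degree < p.degree := by
    apply degree_sub_lt_left
    · rw [degree_X_pow, degree_eq_natDegree h.ne_zero]
    · exact h.ne_zero
    · simp [h.leadingCoeff]
  rwa [degree_eq_natDegree h.ne_zero] at this

lemma dvd_card {F : Type} [Field F] [Fintype F] {k : ℕ} {P : F[X]} (hP : P ≠ 0) :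
    ((PL F k).filter fun a => P ∣ mon k a).card ≤ Fintype.card F ^ (k - P.natDegree) := by
  apply residue_card hP
  intro s hs t ht
  simp only [Finset.mem_filter] at hs ht
  refine ⟨?_, PL_sub hs.1 ht.1⟩
  have := dvd_sub hs.2 ht.2
  simpa [mon] using this

lemma gcd_sum {F : Type} [Field F] [Fintype F] (k : ℕ) :
    ∑ a ∈ PL F k, ∑ b ∈ PL F k,
      Fintype.card F ^ (EuclideanDomain.gcd (mon k a) (mon k b)).natDegree ≤
      (k + 1) * Fintype.card F ^ (2 * k) := by
  set q := Fintype.card F with hq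
  have h1 : ∀ a ∈ PL F k, ∀ b ∈ PL F k,
      q ^ (EuclideanDomain.gcd (mon k a) (mon k b)).natDegree ≤
      ∑ j ∈ Finset.range (k + 1), ∑ h ∈ PL F j,
        (if mon j h ∣ mon k a then 1 else 0) * (if mon j h ∣ mon k b then 1 else 0) * q ^ j := by
    intro a ha b hb
    set G := EuclideanDomain.gcd (mon k a) (mon k b) with hG
    have hGa : G ∣ mon k a := EuclideanDomain.gcd_dvd_left _ _
    have hGb : G ∣ mon k b := EuclideanDomain.gcd_dvd_right _ _
    have hG0 : G ≠ 0 := ne_zero_of_dvd_ne_zero (mon_monic ha).ne_zero hGa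
    have hmon := monic_mul_leadingCoeff_inv hG0
    obtain ⟨h, hh, he⟩ := exists_mon hmon
    have hc : IsUnit (C G.leadingCoeff⁻¹) := by
      rw [isUnit_C]; exact (inv_ne_zero (leadingCoeff_ne_zero.2 hG0)).isUnit
    have hd : (G * C G.leadingCoeff⁻¹).natDegree = G.natDegree :=
      natDegree_mul_leadingCoeff_inv G hG0
    rw [hd] at hh he
    have hle : G.natDegree ≤ k := by
      have := natDegree_le_of_dvd hGa (mon_monic ha).ne_zero
      rwa [mon_natDegree ha] at this
    have hda : mon G.natDegree h ∣ mon k a := by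
      rw [← he]; exact (hc.mul_right_dvd).2 hGa
    have hdb : mon G.natDegree h ∣ mon k b := by
      rw [← he]; exact (hc.mul_right_dvd).2 hGb
    calc q ^ G.natDegree = (if mon G.natDegree h ∣ mon k a then 1 else 0) *
          (if mon G.natDegree h ∣ mon k b then 1 else 0) * q ^ G.natDegree := by
            rw [if_pos hda, if_pos hdb]; simp
      _ ≤ ∑ h ∈ PL F G.natDegree, (if mon G.natDegree h ∣ mon k a then 1 else 0) *
          (if mon G.natDegree h ∣ mon k b then 1 else 0) * q ^ G.natDegree :=
            Finset.single_le_sum (f := fun h => (if mon G.natDegree h ∣ mon k a then 1 else 0) *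
          (if mon G.natDegree h ∣ mon k b then 1 else 0) * q ^ G.natDegree) (by simp) hh
      _ ≤ _ := Finset.single_le_sum (f := fun j => ∑ h ∈ PL F j,
        (if mon j h ∣ mon k a then 1 else 0) * (if mon j h ∣ mon k b then 1 else 0) * q ^ j)
          (by simp) (Finset.mem_range.2 (by omega))
  refine (Finset.sum_le_sum fun a ha => Finset.sum_le_sum fun b hb => h1 a ha b hb).trans ?_
  have h2 : ∑ a ∈ PL F k, ∑ b ∈ PL F k, ∑ j ∈ Finset.range (k + 1), ∑ h ∈ PL F j,
        (if mon j h ∣ mon k a then 1 else 0) * (if mon j h ∣ mon k b then 1 else 0) * q ^ j =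
      ∑ j ∈ Finset.range (k + 1), ∑ h ∈ PL F j,
        ((PL F k).filter fun a => mon j h ∣ mon k a).card ^ 2 * q ^ j := by
    have : ∀ a ∈ PL F k, ∑ b ∈ PL F k, ∑ j ∈ Finset.range (k + 1), ∑ h ∈ PL F j,
        (if mon j h ∣ mon k a then 1 else 0) * (if mon j h ∣ mon k b then 1 else 0) * q ^ j =
        ∑ j ∈ Finset.range (k + 1), ∑ h ∈ PL F j, ∑ b ∈ PL F k,
        (if mon j h ∣ mon k a then 1 else 0) * (if mon j h ∣ mon k b then 1 else 0) * q ^ j := by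
      intro a _
      rw [Finset.sum_comm]
      apply Finset.sum_congr rfl
      intro j _
      rw [Finset.sum_comm]
    rw [Finset.sum_congr rfl this, Finset.sum_comm]
    apply Finset.sum_congr rfl
    intro j _
    rw [Finset.sum_comm]
    apply Finset.sum_congr rfl
    intro h _
    simp_rw [← Finset.sum_mul]
    congr 1
    rw [sq, Finset.card_filter, Finset.sum_mul_sum]
  rw [h2]
  have h3 : ∀ j ∈ Finset.range (k + 1), ∑ h ∈ PL F j,
        ((PL F k).filter fun a => mon j h ∣ mon k a).card ^ 2 * q ^ j ≤ q ^ (2 * k) := by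
    intro j hj
    have hj' : j ≤ k := by have := Finset.mem_range.1 hj; omega
    have h4 : ∀ h ∈ PL F j, ((PL F k).filter fun a => mon j h ∣ mon k a).card ^ 2 * q ^ j ≤
        (q ^ (k - j)) ^ 2 * q ^ j := by
      intro h hh
      have := dvd_card (k := k) (mon_monic hh).ne_zero
      rw [mon_natDegree hh] at this
      gcongr
    refine (Finset.sum_le_card_nsmul _ _ _ h4).trans ?_
    rw [card_PL, smul_eq_mul, ← pow_mul, ← pow_add, ← pow_add]
    apply le_of_eq
    congr 1
    omega
  refine (Finset.sum_le_card_nsmul _ _ _ h3).trans ?_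
  simp

lemma cs_fiber {α β : Type*} [DecidableEq β] (S : Finset α) (Z : α → β) :
    S.card ^ 2 ≤ (S.image Z).card * ∑ s ∈ S, (S.filter fun t => Z t = Z s).card := by
  have h1 : ∑ s ∈ S, (S.filter fun t => Z t = Z s).card =
      ∑ z ∈ S.image Z, (S.filter fun t => Z t = z).card ^ 2 := by
    rw [← Finset.sum_fiberwise_of_maps_to (g := Z) (t := S.image Z)
      (fun s hs => Finset.mem_image_of_mem _ hs)]
    apply Finset.sum_congr rfl
    intro z _
    rw [Finset.sum_congr rfl (g := fun _ => (S.filter fun t => Z t = z).card)]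
    · simp [sq]
    · intro s hs
      rw [(Finset.mem_filter.1 hs).2]
  rw [h1, Finset.card_eq_sum_card_image Z S]
  exact sq_sum_le_card_mul_sum_sq

/-- number of pairs, for fixed `a, b` -/
lemma pair_card {F : Type} [Field F] [Fintype F] {k m d : ℕ} (hkm : k + m ≤ d) (hk : k ≤ m)
    {a b : F[X]} (ha : a ∈ PL F k) (hb : b ∈ PL F k)
    {ι : Type} [Fintype ι] (K : ι → Type) [∀ i, Field (K i)] (φ : ∀ i, F[X] →+* K i)
    (hall : ∀ p : F[X], (∀ i, φ i p = 0) → p ≠ 0 → d ≤ p.natDegree) (w : ∀ i, K i) :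
    ((PL F m ×ˢ PL F m).filter fun g => ∀ i,
      (w i + φ i g.1) * φ i (mon k b) = (w i + φ i g.2) * φ i (mon k a)).card ≤
      Fintype.card F ^ (m - k + (EuclideanDomain.gcd (mon k a) (mon k b)).natDegree) := by
  set S := (PL F m ×ˢ PL F m).filter fun g => ∀ i,
      (w i + φ i g.1) * φ i (mon k b) = (w i + φ i g.2) * φ i (mon k a) with hS
  set A := mon k a with hA
  set B := mon k b with hB
  have hA0 : A ≠ 0 := (mon_monic ha).ne_zero
  have hB0 : B ≠ 0 := (mon_monic hb).ne_zero
  have hAd : A.natDegree = k := mon_natDegree ha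
  have hBd : B.natDegree = k := mon_natDegree hb
  have key : ∀ s ∈ S, ∀ t ∈ S, (s.1 - t.1) * B = (s.2 - t.2) * A := by
    intro s hs t ht
    simp only [hS, Finset.mem_filter, Finset.mem_product] at hs ht
    by_contra hne
    have h0 : (s.1 - t.1) * B - (s.2 - t.2) * A ≠ 0 := sub_ne_zero.2 hne
    have h1 := hall _ (fun i => by
      have e1 := hs.2 i
      have e2 := ht.2 i
      simp only [map_sub, map_mul]
      linear_combination e1 - e2) h0
    have h2 : (s.1 - t.1) * B - (s.2 - t.2) * A ∈ PL F (m + k) := by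
      apply PL_sub
      · rw [mem_PL, degree_mul, degree_eq_natDegree hB0, hBd]
        have := mem_PL.1 (PL_sub hs.1.1 ht.1.1)
        push_cast
        exact WithBot.add_lt_add_right (by simp) this
      · rw [mem_PL, degree_mul, degree_eq_natDegree hA0, hAd]
        have := mem_PL.1 (PL_sub hs.1.2 ht.1.2)
        push_cast
        exact WithBot.add_lt_add_right (by simp) this
    have := natDegree_lt_of_mem_PL h2 h0
    omega
  set G := EuclideanDomain.gcd A B with hG
  obtain ⟨A', hA'⟩ : G ∣ A := EuclideanDomain.gcd_dvd_left _ _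
  obtain ⟨B', hB'⟩ : G ∣ B := EuclideanDomain.gcd_dvd_right _ _
  have hG0 : G ≠ 0 := fun h => hA0 (by rw [hA', h, zero_mul])
  have hA'0 : A' ≠ 0 := fun h => hA0 (by rw [hA', h, mul_zero])
  have hcop : IsCoprime A' B' := by
    have hbez := EuclideanDomain.gcd_eq_gcd_ab A B
    rw [← hG] at hbez
    refine ⟨EuclideanDomain.gcdA A B, EuclideanDomain.gcdB A B, ?_⟩
    apply mul_left_cancel₀ hG0
    calc G * (EuclideanDomain.gcdA A B * A' + EuclideanDomain.gcdB A B * B')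
        = (G * A') * EuclideanDomain.gcdA A B + (G * B') * EuclideanDomain.gcdB A B := by ring
      _ = G * 1 := by rw [← hA', ← hB', ← hbez, mul_one]
  have hinj : Set.InjOn Prod.fst (S : Set (F[X] × F[X])) := by
    intro s hs t ht h
    have := key s hs t ht
    rw [h, sub_self, zero_mul] at this
    rcases mul_eq_zero.1 this.symm with h1 | h1
    · exact Prod.ext h (sub_eq_zero.1 h1)
    · exact absurd h1 hA0
  rw [← Finset.card_image_of_injOn hinj]
  have hdeg : A'.natDegree + G.natDegree = k := by
    rw [← hAd]; conv_rhs => rw [hA', natDegree_mul hG0 hA'0]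
    ring
  have := residue_card (m := m) (S := S.image Prod.fst) hA'0 (by
    intro s hs t ht
    obtain ⟨s, hs', rfl⟩ := Finset.mem_image.1 hs
    obtain ⟨t, ht', rfl⟩ := Finset.mem_image.1 ht
    clear hs ht
    refine ⟨?_, ?_⟩
    · have e := key s hs' t ht'
      have e' : (s.1 - t.1) * B' = (s.2 - t.2) * A' := by
        apply mul_left_cancel₀ hG0
        calc G * ((s.1 - t.1) * B') = (s.1 - t.1) * (G * B') := by ring
          _ = (s.2 - t.2) * (G * A') := by rw [← hB', ← hA', e]
          _ = _ := by ring
      exact hcop.dvd_of_dvd_mul_right ⟨s.2 - t.2, by rw [e']; ring⟩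
    · simp only [hS, Finset.mem_filter, Finset.mem_product] at hs' ht'
      exact PL_sub hs'.1.1 ht'.1.1)
  refine this.trans (Nat.pow_le_pow_right Fintype.card_pos ?_)
  omega


lemma image_card {F : Type} [Field F] [Fintype F] {k m d : ℕ} (hkm : k + m ≤ d) (hk : k ≤ m)
    {ι : Type} [Fintype ι] (K : ι → Type) [∀ i, Field (K i)] (φ : ∀ i, F[X] →+* K i)
    (hall : ∀ p : F[X], (∀ i, φ i p = 0) → p ≠ 0 → d ≤ p.natDegree) (w : ∀ i, K i)
    (A : Finset F[X]) (hA : A ⊆ PL F k) (hA0 : ∀ a ∈ A, ∀ i, φ i (mon k a) ≠ 0) :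
    (A.card * Fintype.card F ^ m) ^ 2 ≤
    ((A ×ˢ PL F m).image fun s i => (w i + φ i s.2) / φ i (mon k s.1)).card *
      ((k + 1) * Fintype.card F ^ (2 * k + (m - k))) := by
  have h1 := cs_fiber (A ×ˢ PL F m) (fun s i => (w i + φ i s.2) / φ i (mon k s.1))
  rw [Finset.card_product, card_PL] at h1
  refine h1.trans (Nat.mul_le_mul_left _ ?_)
  have h2 : ∀ a ∈ A, ∀ b ∈ A, ∑ g ∈ PL F m, ∑ g' ∈ PL F m,
      (if (fun i => (w i + φ i g') / φ i (mon k b)) = (fun i => (w i + φ i g) / φ i (mon k a))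
        then 1 else 0) ≤ Fintype.card F ^ (m - k) *
          Fintype.card F ^ (EuclideanDomain.gcd (mon k a) (mon k b)).natDegree := by
    intro a ha b hb
    rw [← pow_add]
    refine le_trans ?_ (pair_card hkm hk (hA ha) (hA hb) K φ hall w)
    rw [Finset.card_filter, Finset.sum_product]
    apply Finset.sum_le_sum
    intro g _
    apply Finset.sum_le_sum
    intro g' _
    split_ifs with h3 h4
    · exact le_rfl
    · exfalso
      apply h4
      intro i
      have := congrFun h3 i
      rw [div_eq_div_iff (hA0 b hb i) (hA0 a ha i)] at this
      exact this.symm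
    · exact Nat.zero_le _
    · exact Nat.zero_le _
  calc _ = ∑ a ∈ A, ∑ g ∈ PL F m, ∑ b ∈ A, ∑ g' ∈ PL F m,
      (if (fun i => (w i + φ i g') / φ i (mon k b)) = (fun i => (w i + φ i g) / φ i (mon k a))
        then 1 else 0) := by
        rw [Finset.sum_product]
        apply Finset.sum_congr rfl
        intro a _
        apply Finset.sum_congr rfl
        intro g _
        rw [Finset.card_filter, Finset.sum_product]
    _ = ∑ a ∈ A, ∑ b ∈ A, ∑ g ∈ PL F m, ∑ g' ∈ PL F m,
      (if (fun i => (w i + φ i g') / φ i (mon k b)) = (fun i => (w i + φ i g) / φ i (mon k a))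
        then 1 else 0) := by
        apply Finset.sum_congr rfl
        intro a _
        rw [Finset.sum_comm]
    _ ≤ ∑ a ∈ A, ∑ b ∈ A, Fintype.card F ^ (m - k) *
          Fintype.card F ^ (EuclideanDomain.gcd (mon k a) (mon k b)).natDegree :=
        Finset.sum_le_sum fun a ha => Finset.sum_le_sum fun b hb => h2 a ha b hb
    _ ≤ ∑ a ∈ PL F k, ∑ b ∈ PL F k, Fintype.card F ^ (m - k) *
          Fintype.card F ^ (EuclideanDomain.gcd (mon k a) (mon k b)).natDegree := by
        refine (Finset.sum_le_sum fun a _ => Finset.sum_le_sum_of_subset hA).trans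
          (Finset.sum_le_sum_of_subset hA)
    _ = Fintype.card F ^ (m - k) * ∑ a ∈ PL F k, ∑ b ∈ PL F k,
          Fintype.card F ^ (EuclideanDomain.gcd (mon k a) (mon k b)).natDegree := by
        simp_rw [Finset.mul_sum]
    _ ≤ Fintype.card F ^ (m - k) * ((k + 1) * Fintype.card F ^ (2 * k)) :=
        Nat.mul_le_mul_left _ (gcd_sum k)
    _ = _ := by rw [pow_add]; ring

lemma many_coprime {F : Type} [Field F] [Fintype F] {k κ : ℕ} (hκk : κ ≤ k)
    {ι : Type} [Fintype ι] (P : ι → F[X]) (hP : ∀ i, κ < (P i).natDegree)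
    (ht : 2 * Fintype.card ι ≤ Fintype.card F ^ κ) :
    Fintype.card F ^ k ≤ 2 * ((PL F k).filter fun a => ∀ i, ¬ P i ∣ mon k a).card := by
  have h1 : (PL F k) ⊆ ((PL F k).filter fun a => ∀ i, ¬ P i ∣ mon k a) ∪
      Finset.univ.biUnion (fun i => (PL F k).filter fun a => P i ∣ mon k a) := by
    intro a ha
    by_cases h : ∀ i, ¬ P i ∣ mon k a
    · exact Finset.mem_union_left _ (Finset.mem_filter.2 ⟨ha, h⟩)
    · push Not at h
      obtain ⟨i, hi⟩ := h
      exact Finset.mem_union_right _ (Finset.mem_biUnion.2 ⟨i, Finset.mem_univ _,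
        Finset.mem_filter.2 ⟨ha, hi⟩⟩)
  have h2 := (Finset.card_le_card h1).trans (Finset.card_union_le _ _)
  rw [card_PL] at h2
  have h3 : (Finset.univ.biUnion (fun i => (PL F k).filter fun a => P i ∣ mon k a)).card ≤
      Fintype.card ι * Fintype.card F ^ (k - κ) := by
    refine Finset.card_biUnion_le.trans ?_
    refine (Finset.sum_le_card_nsmul _ _ (Fintype.card F ^ (k - κ)) ?_).trans (by simp)
    intro i _
    have h0 : P i ≠ 0 := by
      intro h; have := hP i; rw [h] at this; simp at this
    refine (dvd_card h0).trans (Nat.pow_le_pow_right Fintype.card_pos ?_)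
    have := hP i
    omega
  have h4 : 2 * (Fintype.card ι * Fintype.card F ^ (k - κ)) ≤ Fintype.card F ^ k := by
    calc _ = 2 * Fintype.card ι * Fintype.card F ^ (k - κ) := by ring
      _ ≤ Fintype.card F ^ κ * Fintype.card F ^ (k - κ) := Nat.mul_le_mul_right _ ht
      _ = _ := by rw [← pow_add]; congr 1; omega
  omega

/-- large inner sums -/
lemma large_sum {F : Type} [Field F] [Fintype F] {κ : ℕ}
    {ι : Type} [Fintype ι] (K : ι → Type) [∀ i, Field (K i)] [∀ i, Fintype (K i)]
    (φ : ∀ i, F[X] →+* K i) (hinj : ∀ i, ∀ b ∈ PL F κ, ∀ c ∈ PL F κ, φ i b = φ i c → b = c)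
    (ht : 2 * Fintype.card ι ≤ Fintype.card F ^ κ) (z : ∀ i, K i) (ε : ℤ) (hε : ε = 1 ∨ ε = -1)
    (h : ∀ b ∈ PL F κ, ∏ i, quadraticChar (K i) (z i + φ i b) ≠ ε) :
    (Fintype.card F : ℤ) ^ κ ≤
      2 * |∑ b : PL F κ, ∏ i, quadraticChar (K i) (z i + φ i b)| := by
  set Y : F[X] → ℤ := fun b => ∏ i, quadraticChar (K i) (z i + φ i b) with hY
  have hY0 : ∀ b, (∀ i, z i + φ i b ≠ 0) → Y b = 1 ∨ Y b = -1 := by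
    intro b hb
    have : Y b ^ 2 = 1 := by
      rw [hY]; simp only; rw [← Finset.prod_pow]
      exact Finset.prod_eq_one fun i _ => quadraticChar_sq_one (hb i)
    exact sq_eq_one_iff.1 this
  set T := (PL F κ).filter fun b => ∃ i, z i + φ i b = 0 with hT
  have hTc : T.card ≤ Fintype.card ι := by
    have h1 : T ⊆ Finset.univ.biUnion (fun i => (PL F κ).filter fun b => z i + φ i b = 0) := by
      intro b hb
      obtain ⟨hb, i, hi⟩ := Finset.mem_filter.1 hb
      exact Finset.mem_biUnion.2 ⟨i, Finset.mem_univ _, Finset.mem_filter.2 ⟨hb, hi⟩⟩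
    refine (Finset.card_le_card h1).trans (Finset.card_biUnion_le.trans ?_)
    refine (Finset.sum_le_card_nsmul _ _ 1 ?_).trans (by simp)
    intro i _
    rw [Finset.card_le_one]
    intro b hb c hc
    simp only [Finset.mem_filter] at hb hc
    exact hinj i b hb.1 c hc.1 (by linear_combination hb.2 - hc.2)
  have hlow : ∀ b ∈ PL F κ, 1 - (if ∃ i, z i + φ i b = 0 then 1 else 0) ≤ (-ε) * Y b := by
    intro b hb
    split_ifs with h1
    · obtain ⟨i, hi⟩ := h1
      have : Y b = 0 := Finset.prod_eq_zero (Finset.mem_univ i) (by rw [hi]; simp)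
      rw [this]; simp
    · push Not at h1
      have h2 := h b hb
      rcases hY0 b h1 with h3 | h3 <;> rcases hε with h4 | h4 <;> rw [h3, h4] <;>
        first | exact absurd (h3.trans h4.symm) h2 | norm_num
  have hsum := Finset.sum_le_sum hlow
  rw [Finset.sum_sub_distrib, ← Finset.mul_sum, ← Finset.sum_filter,
    Finset.sum_const, Finset.sum_const, card_PL, ← hT] at hsum
  have h5 : ∑ b : PL F κ, Y b = ∑ b ∈ PL F κ, Y b := Finset.sum_coe_sort (PL F κ) Y
  rw [h5]
  have h6 : -ε * ∑ b ∈ PL F κ, Y b ≤ |∑ b ∈ PL F κ, Y b| := by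
    rcases hε with h4 | h4 <;> rw [h4]
    · rw [neg_one_mul]; exact neg_le_abs _
    · rw [neg_neg, one_mul]; exact le_abs_self _
  have h7 : (2 * T.card : ℤ) ≤ (Fintype.card F : ℤ) ^ κ := by
    have : 2 * T.card ≤ Fintype.card F ^ κ := by omega
    exact_mod_cast this
  simp only [nsmul_eq_mul, mul_one, Nat.cast_pow] at hsum
  linarith


set_option maxHeartbeats 2000000 in
theorem thmB {F : Type} [Field F] [Fintype F] (a0 : ℕ) (ha0 : 0 < a0)
    (hF : Fintype.card F = 3 ^ a0) (N0 : ℕ) :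
    ∃ κ0 : ℕ, ∀ κ ≥ κ0, ∀ (ι : Type) [Fintype ι] (K : ι → Type) [∀ i, Field (K i)]
      [∀ i, Fintype (K i)] [∀ i, CharP (K i) 3] (φ : ∀ i, F[X] →+* K i) (P : ι → F[X])
      (_ : ∀ i p, φ i p = 0 ↔ P i ∣ p)
      (_ : ∀ i, Fintype.card (K i) = Fintype.card F ^ (P i).natDegree)
      (_ : ∀ i, κ < (P i).natDegree) (d : ℕ) (_ : d = ∑ i, (P i).natDegree)
      (_ : 6 * κ < d) (_ : d ≤ N0 * κ)
      (_ : ∀ p : F[X], (∀ i, φ i p = 0) → p ≠ 0 → d ≤ p.natDegree)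
      (w : ∀ i, K i) (ε : ℤ) (_ : ε = 1 ∨ ε = -1),
      ∃ g ∈ PL F (d / 4 + 2 * κ), ∏ i, quadraticChar (K i) (w i + φ i g) = ε := by
  set q := Fintype.card F with hq
  set r := N0 + 1 with hr
  set Cn := 4 ^ r * (r ^ (2 * r) + (6 * r + 3) ^ r) with hC
  refine ⟨q ^ 3 * 16 * (N0 + 2) ^ 2 * Cn ^ 2 * 3 ^ r + 2 * r + 1, ?_⟩
  intro κ hκ ι _ K _ _ _ φ P hφ hcard hκP d hd h6 hdN hall w ε hε
  have hq3 : 3 ≤ q := by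
    rw [hF]; calc 3 = 3 ^ 1 := by norm_num
      _ ≤ _ := Nat.pow_le_pow_right (by norm_num) ha0
  have hκpos : 0 < κ := by omega
  have hqκ : κ < q ^ κ := Nat.lt_pow_self (by omega)
  have ht : Fintype.card ι ≤ N0 := by
    have h1 : Fintype.card ι * κ ≤ d := by
      rw [hd]
      have := Finset.card_nsmul_le_sum Finset.univ (fun i => (P i).natDegree) κ
        (fun i _ => (hκP i).le)
      simpa using this
    exact Nat.le_of_mul_le_mul_right (h1.trans hdN) hκpos
  have ht2 : 2 * Fintype.card ι ≤ q ^ κ := by omega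
  set k := d / 4 + κ with hk
  set m := d / 4 + 2 * κ with hm
  by_contra hcon
  push Not at hcon
  set A := (PL F k).filter fun a => ∀ i, ¬ P i ∣ mon k a with hA
  have hAc : q ^ k ≤ 2 * A.card := many_coprime (by omega) P hκP ht2
  have hA0 : ∀ a ∈ A, ∀ i, φ i (mon k a) ≠ 0 := by
    intro a ha i h
    exact (Finset.mem_filter.1 ha).2 i ((hφ i _).1 h)
  have himg := image_card (F := F) (k := k) (m := m) (d := d) (by omega) (by omega) K φ hall w A
    (Finset.filter_subset _ _) hA0
  set Z := ((A ×ˢ PL F m).image fun s i => (w i + φ i s.2) / φ i (mon k s.1)) with hZ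
  -- lower bound for the image
  have hlow : q ^ (2 * m - κ) ≤ 4 * (k + 1) * Z.card := by
    have h1 : q ^ (2 * k + κ) * q ^ (2 * m - κ) ≤ q ^ (2 * k + κ) * (4 * (k + 1) * Z.card) := by
      calc q ^ (2 * k + κ) * q ^ (2 * m - κ) = (q ^ k * q ^ m) ^ 2 := by
            rw [← pow_add, ← pow_add, ← pow_mul]; congr 1; omega
        _ ≤ (2 * A.card * q ^ m) ^ 2 := by gcongr
        _ = 4 * (A.card * q ^ m) ^ 2 := by ring
        _ ≤ 4 * (Z.card * ((k + 1) * q ^ (2 * k + (m - k)))) := by gcongr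
        _ = _ := by
          have : m - k = κ := by omega
          rw [this]; ring
    exact Nat.le_of_mul_le_mul_left h1 (by positivity)
  -- the moment bound
  have hinj : ∀ i, ∀ b ∈ PL F κ, ∀ c ∈ PL F κ, φ i b = φ i c → b = c := by
    intro i b hb c hc h
    have h1 : φ i (b - c) = 0 := by rw [map_sub, h, sub_self]
    rw [hφ] at h1
    by_contra hne
    have h2 := natDegree_le_of_dvd h1 (sub_ne_zero.2 hne)
    have h3 := natDegree_lt_of_mem_PL (PL_sub hb hc) (sub_ne_zero.2 hne)
    have := hκP i
    omega
  have hbig : ∀ z ∈ Z, (q : ℤ) ^ κ ≤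
      2 * |∑ b : PL F κ, ∏ i, quadraticChar (K i) (z i + φ i b)| := by
    intro z hz
    obtain ⟨⟨a, g⟩, hs, rfl⟩ := Finset.mem_image.1 hz
    obtain ⟨ha, hg⟩ := Finset.mem_product.1 hs
    simp only at ha hg
    have hX2 : (∏ i, quadraticChar (K i) (φ i (mon k a))) ^ 2 = 1 := by
      rw [← Finset.prod_pow]
      exact Finset.prod_eq_one fun i _ => quadraticChar_sq_one (hA0 a ha i)
    set X0 := ∏ i, quadraticChar (K i) (φ i (mon k a)) with hX0
    apply large_sum K φ hinj ht2 _ (ε * X0)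
    · rcases sq_eq_one_iff.1 hX2 with h | h <;> rcases hε with h' | h' <;> rw [h, h'] <;> simp
    · intro b hb h
      have hak := (Finset.mem_filter.1 ha).1
      have hmem : g + mon k a * b ∈ PL F m := by
        apply PL_add hg
        rw [mem_PL, degree_mul, degree_eq_natDegree (mon_monic hak).ne_zero, mon_natDegree hak]
        have h1 : m = k + κ := by omega
        rw [h1]
        push_cast
        exact WithBot.add_lt_add_left (by simp) (mem_PL.1 hb)
      apply hcon _ hmem
      have : ∏ i, quadraticChar (K i) (w i + φ i (g + mon k a * b)) =
          X0 * ∏ i, quadraticChar (K i) ((w i + φ i g) / φ i (mon k a) + φ i b) := by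
        rw [hX0, ← Finset.prod_mul_distrib]
        apply Finset.prod_congr rfl
        intro i _
        rw [← map_mul]
        congr 1
        have := hA0 a ha i
        rw [map_add, map_mul]
        field_simp
        ring
      rw [this, h]
      linear_combination ε * hX2
  have hcardK : ∀ i, Fintype.card (K i) = 3 ^ (a0 * (P i).natDegree) := by
    intro i; rw [hcard, hF, pow_mul]
  have hmom := moment_bound K (fun i => a0 * (P i).natDegree) hcardK (B := PL F κ)
    (fun i b => φ i b) (fun i b c h => Subtype.ext (hinj i b b.2 c c.2 h)) r (by omega)
  rw [Fintype.card_coe, card_PL] at hmom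
  set R : ℕ := ∏ i, 3 ^ (a0 * (P i).natDegree - a0 * (P i).natDegree / 2) with hR
  have hR1 : 1 ≤ R := Nat.one_le_iff_ne_zero.2 (Finset.prod_ne_zero_iff.2 fun i _ => by positivity)
  have hprod1 : ∏ i, 3 ^ (a0 * (P i).natDegree) = q ^ d := by
    rw [hd, ← Finset.prod_pow_eq_pow_sum]
    apply Finset.prod_congr rfl
    intro i _
    rw [hF, pow_mul]
  have hprod2 : ∏ i : ι, ((6 * r + 3) * 3 ^ (a0 * (P i).natDegree - a0 * (P i).natDegree / 2))
      = (6 * r + 3) ^ Fintype.card ι * R := by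
    rw [Finset.prod_mul_distrib, Finset.prod_const, Finset.card_univ]
  have hup : Z.card * (q ^ κ) ^ (2 * r) ≤ 4 ^ r * (r ^ (2 * r) * (q ^ κ) ^ r * q ^ d +
      (q ^ κ) ^ (2 * r) * ((6 * r + 3) ^ Fintype.card ι * R)) := by
    have h1 : (Z.card : ℤ) * ((q : ℤ) ^ κ) ^ (2 * r) ≤ 4 ^ r *
        ∑ z : (∀ i, K i), (∑ b : PL F κ, ∏ i, quadraticChar (K i) (z i + φ i b)) ^ (2 * r) := by
      calc (Z.card : ℤ) * ((q : ℤ) ^ κ) ^ (2 * r) = ∑ z ∈ Z, ((q : ℤ) ^ κ) ^ (2 * r) := by simp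
        _ ≤ ∑ z ∈ Z, 4 ^ r *
            (∑ b : PL F κ, ∏ i, quadraticChar (K i) (z i + φ i b)) ^ (2 * r) := by
            apply Finset.sum_le_sum
            intro z hz
            calc ((q : ℤ) ^ κ) ^ (2 * r) ≤
              (2 * |∑ b : PL F κ, ∏ i, quadraticChar (K i) (z i + φ i b)|) ^ (2 * r) :=
                pow_le_pow_left₀ (by positivity) (hbig z hz) _
              _ = _ := by
                rw [mul_pow, (even_two_mul r).pow_abs, pow_mul]; norm_num
        _ ≤ ∑ z : (∀ i, K i), 4 ^ r *
            (∑ b : PL F κ, ∏ i, quadraticChar (K i) (z i + φ i b)) ^ (2 * r) := by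
            apply Finset.sum_le_univ_sum_of_nonneg
            intro z
            have := (even_two_mul r).pow_nonneg
              (∑ b : PL F κ, ∏ i, quadraticChar (K i) (z i + φ i b))
            positivity
        _ = _ := by rw [Finset.mul_sum]
    have h2 := h1.trans (mul_le_mul_of_nonneg_left hmom (by positivity))
    rw [← hprod1, ← hprod2]
    exact_mod_cast h2
  have hqr : q ^ d ≤ (q ^ κ) ^ r := by
    rw [← pow_mul]
    apply Nat.pow_le_pow_right (by omega)
    calc d ≤ N0 * κ := hdN
      _ ≤ κ * r := by rw [hr]; nlinarith
  have hM : Z.card ≤ Cn * R := by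
    have h1 : (q ^ κ) ^ (2 * r) * Z.card ≤ (q ^ κ) ^ (2 * r) * (Cn * R) := by
      calc (q ^ κ) ^ (2 * r) * Z.card = Z.card * (q ^ κ) ^ (2 * r) := by ring
        _ ≤ _ := hup
        _ ≤ 4 ^ r * (r ^ (2 * r) * (q ^ κ) ^ r * (q ^ κ) ^ r * R +
      (q ^ κ) ^ (2 * r) * ((6 * r + 3) ^ r * R)) := by
          apply Nat.mul_le_mul_left
          apply Nat.add_le_add
          · exact (Nat.mul_le_mul_left _ hqr).trans (Nat.le_mul_of_pos_right _ hR1)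
          · apply Nat.mul_le_mul_left
            apply Nat.mul_le_mul_right
            exact Nat.pow_le_pow_right (by omega) (by omega)
        _ = _ := by rw [hC]; ring
    exact Nat.le_of_mul_le_mul_left h1 (by positivity)
  have hR2 : R ^ 2 ≤ 3 ^ r * q ^ d := by
    calc R ^ 2 = ∏ i, (3 ^ (a0 * (P i).natDegree - a0 * (P i).natDegree / 2)) ^ 2 := by
          rw [hR, Finset.prod_pow]
      _ ≤ ∏ i, 3 * 3 ^ (a0 * (P i).natDegree) := by
          apply Finset.prod_le_prod'
          intro i _
          rw [← pow_mul, mul_comm 3, ← pow_succ]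
          apply Nat.pow_le_pow_right (by norm_num)
          omega
      _ = 3 ^ Fintype.card ι * q ^ d := by
          rw [Finset.prod_mul_distrib, hprod1, Finset.prod_const, Finset.card_univ]
      _ ≤ _ := by gcongr <;> omega
  have hk1 : k + 1 ≤ (N0 + 2) * κ := by
    have : d / 4 ≤ d := Nat.div_le_self _ _
    calc k + 1 ≤ N0 * κ + κ + κ := by omega
      _ = _ := by ring
  have hfin : q ^ d * q ^ (6 * κ) ≤ q ^ d * (κ ^ 2 *
      (q ^ 3 * 16 * (N0 + 2) ^ 2 * Cn ^ 2 * 3 ^ r)) := by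
    calc q ^ d * q ^ (6 * κ) ≤ q ^ 3 * (q ^ (2 * m - κ)) ^ 2 := by
          rw [← pow_add, ← pow_mul, ← pow_add]
          apply Nat.pow_le_pow_right (by omega)
          omega
      _ ≤ q ^ 3 * (4 * ((N0 + 2) * κ) * (Cn * R)) ^ 2 := by
          gcongr
          exact hlow.trans (by gcongr)
      _ = q ^ 3 * 16 * ((N0 + 2) * κ) ^ 2 * Cn ^ 2 * R ^ 2 := by ring
      _ ≤ q ^ 3 * 16 * ((N0 + 2) * κ) ^ 2 * Cn ^ 2 * (3 ^ r * q ^ d) := by gcongr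
      _ = _ := by ring
  have hfin2 := Nat.le_of_mul_le_mul_left hfin (by positivity)
  have hfin3 : q ^ (6 * κ) < q ^ (6 * κ) := by
    calc q ^ (6 * κ) ≤ _ := hfin2
      _ ≤ κ ^ 2 * κ := by gcongr; omega
      _ < (q ^ κ) ^ 2 * q ^ κ := by
        have : κ ^ 2 ≤ (q ^ κ) ^ 2 := by gcongr
        exact Nat.mul_lt_mul_of_le_of_lt this hqκ (by positivity)
      _ = q ^ (3 * κ) := by ring
      _ ≤ _ := Nat.pow_le_pow_right (by omega) (by omega)
  exact lt_irrefl _ hfin3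


section residueField
variable {F : Type} [Field F] [Fintype F] (P : F[X]) [hP : Fact (Irreducible P)]

lemma adjoinRoot_modfin : Module.Finite F (AdjoinRoot P) :=
  (AdjoinRoot.powerBasis hP.out.ne_zero).finite

noncomputable instance adjoinRootFintype : Fintype (AdjoinRoot P) :=
  have := adjoinRoot_modfin P
  have := Module.finite_of_finite F (M := AdjoinRoot P)
  Fintype.ofFinite _

lemma adjoinRoot_finrank : Module.finrank F (AdjoinRoot P) = P.natDegree := by
  rw [(AdjoinRoot.powerBasis hP.out.ne_zero).finrank, AdjoinRoot.powerBasis_dim]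

lemma adjoinRoot_card : Fintype.card (AdjoinRoot P) = Fintype.card F ^ P.natDegree := by
  rw [← adjoinRoot_finrank P, Module.card_eq_pow_finrank (K := F)]

lemma adjoinRoot_charP [CharP F 3] : CharP (AdjoinRoot P) 3 :=
  charP_of_injective_algebraMap (algebraMap F (AdjoinRoot P)).injective 3

noncomputable def frobConj (i : Fin P.natDegree) : AdjoinRoot P :=
  AdjoinRoot.root P ^ (Fintype.card F ^ (i : ℕ))

lemma aeval_pow_card (G : F[X]) (x : AdjoinRoot P) (i : ℕ) :
    (G.map (algebraMap F (AdjoinRoot P))).eval (x ^ (Fintype.card F ^ i)) =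
    ((G.map (algebraMap F (AdjoinRoot P))).eval x) ^ (Fintype.card F ^ i) := by
  have h := (FiniteField.frobeniusAlgEquivOfAlgebraic F (AdjoinRoot P) ^ i)
  have h2 : ∀ y : AdjoinRoot P, (FiniteField.frobeniusAlgEquivOfAlgebraic F (AdjoinRoot P) ^ i) y =
      y ^ (Fintype.card F ^ i) := by
    intro y
    rw [AlgEquiv.coe_pow, FiniteField.coe_frobeniusAlgEquivOfAlgebraic, pow_iterate]
  rw [← h2, ← h2]
  simp only [eval_map_algebraMap]
  exact aeval_algHom_apply
    ((FiniteField.frobeniusAlgEquivOfAlgebraic F (AdjoinRoot P) ^ i) : _ →ₐ[F] AdjoinRoot P) x G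

lemma frobConj_injective : Function.Injective (frobConj P) := by
  have hb := FiniteField.bijective_frobeniusAlgEquivOfAlgebraic_pow F (AdjoinRoot P)
  intro i j hij
  have h2 : ∀ (i : ℕ) (y : AdjoinRoot P),
      (FiniteField.frobeniusAlgEquivOfAlgebraic F (AdjoinRoot P) ^ i) y =
      y ^ (Fintype.card F ^ i) := by
    intro i y
    rw [AlgEquiv.coe_pow, FiniteField.coe_frobeniusAlgEquivOfAlgebraic, pow_iterate]
  have h3 : (FiniteField.frobeniusAlgEquivOfAlgebraic F (AdjoinRoot P) ^ (i : ℕ)) =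
      (FiniteField.frobeniusAlgEquivOfAlgebraic F (AdjoinRoot P) ^ (j : ℕ)) := by
    have : ((FiniteField.frobeniusAlgEquivOfAlgebraic F (AdjoinRoot P) ^ (i : ℕ) :
        AdjoinRoot P ≃ₐ[F] AdjoinRoot P) : AdjoinRoot P →ₐ[F] AdjoinRoot P) =
      ((FiniteField.frobeniusAlgEquivOfAlgebraic F (AdjoinRoot P) ^ (j : ℕ) :
        AdjoinRoot P ≃ₐ[F] AdjoinRoot P) : AdjoinRoot P →ₐ[F] AdjoinRoot P) := by
      apply AdjoinRoot.algHom_ext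
      show (FiniteField.frobeniusAlgEquivOfAlgebraic F (AdjoinRoot P) ^ (i : ℕ)) _ =
        (FiniteField.frobeniusAlgEquivOfAlgebraic F (AdjoinRoot P) ^ (j : ℕ)) _
      rw [h2, h2]; exact hij
    ext x
    exact DFunLike.congr_fun this x
  have hf := adjoinRoot_finrank P
  have := @hb.1 ⟨i, by rw [hf]; exact i.2⟩ ⟨j, by rw [hf]; exact j.2⟩ h3
  ext
  simpa using this

lemma map_eq_nodal (hm : P.Monic) :
    P.map (algebraMap F (AdjoinRoot P)) = Lagrange.nodal Finset.univ (frobConj P) := by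
  refine eq_of_monic_of_dvd_of_natDegree_le (Lagrange.nodal_monic) (hm.map _) ?_ ?_
  · rw [Lagrange.nodal]
    apply Finset.prod_dvd_of_coprime
    · intro i _ j _ hij
      exact pairwise_coprime_X_sub_C (frobConj_injective P) hij
    · intro i _
      rw [dvd_iff_isRoot, IsRoot, frobConj, aeval_pow_card, eval_map_algebraMap,
        AdjoinRoot.aeval_eq, AdjoinRoot.mk_self, zero_pow]
      exact pow_ne_zero _ Fintype.card_ne_zero
  · rw [Lagrange.natDegree_nodal, hm.natDegree_map]; simp


/-- resultant with natural degrees -/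
noncomputable def rs {R : Type} [CommRing R] (f g : R[X]) : R :=
  resultant f g f.natDegree g.natDegree

lemma map_rs (hm : P.Monic) (G : F[X]) :
    algebraMap F (AdjoinRoot P) (rs P G) =
      ∏ i, (G.map (algebraMap F (AdjoinRoot P))).eval (frobConj P i) := by
  rw [rs, ← resultant_map_map, map_eq_nodal P hm]
  have h1 := resultant_prod_left Finset.univ (fun i => X - C (frobConj P i))
    (G.map (algebraMap F (AdjoinRoot P))) G.natDegree (by simp) natDegree_map_le
  have h2 : (∏ i, (X - C (frobConj P i))).natDegree = P.natDegree := by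
    have := Lagrange.natDegree_nodal (s := Finset.univ) (v := frobConj P)
    rw [Lagrange.nodal] at this
    rw [this]; simp
  rw [h2] at h1
  rw [Lagrange.nodal, h1]
  apply Finset.prod_congr rfl
  intro i _
  rw [natDegree_X_sub_C]
  exact resultant_X_sub_C_left _ _ _ natDegree_map_le

lemma ringChar_ne_two (L : Type*) [Field L] [CharP L 3] : ringChar L ≠ 2 := by
  rw [ringChar.eq L 3]; norm_num

lemma card_odd (L : Type*) [Field L] [Fintype L] [CharP L 3] : Odd (Fintype.card L) :=
  Nat.odd_iff.2 (FiniteField.odd_card_of_char_ne_two (ringChar_ne_two L))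

lemma chi_rs [CharP F 3] (hm : P.Monic) (G : F[X]) :
    quadraticChar F (rs P G) = quadraticChar (AdjoinRoot P) (AdjoinRoot.mk P G) := by
  have := adjoinRoot_charP P
  apply MulChar.IsQuadratic.eq_of_eq_coe (quadraticChar_isQuadratic F)
    (quadraticChar_isQuadratic (AdjoinRoot P)) (ringChar_ne_two (AdjoinRoot P))
  have h1 := quadraticChar_eq_pow_of_char_ne_two' (ringChar_ne_two F) (rs P G)
  have h2 := quadraticChar_eq_pow_of_char_ne_two' (ringChar_ne_two (AdjoinRoot P))
    (AdjoinRoot.mk P G)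
  have h3 := congrArg (algebraMap F (AdjoinRoot P)) h1
  rw [map_pow, map_rs P hm, map_intCast] at h3
  rw [h2, h3]
  simp_rw [frobConj, aeval_pow_card]
  rw [Finset.prod_pow_eq_pow_sum, ← pow_mul, eval_map_algebraMap, AdjoinRoot.aeval_eq]
  congr 1
  rw [adjoinRoot_card, Fin.sum_univ_eq_sum_range (fun i => Fintype.card F ^ i)]
  obtain ⟨t, ht⟩ := card_odd F
  rw [ht]
  have h4 : (∑ i ∈ Finset.range P.natDegree, (2 * t + 1) ^ i) * (2 * t) + 1 =
      (2 * t + 1) ^ P.natDegree := by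
    have := geom_sum_mul_add (2 * t) P.natDegree
    exact this
  have h5 : (2 * t + 1) / 2 = t := by omega
  rw [h5, ← h4]
  have : (∑ i ∈ Finset.range P.natDegree, (2 * t + 1) ^ i) * (2 * t) + 1 =
    2 * ((∑ i ∈ Finset.range P.natDegree, (2 * t + 1) ^ i) * t) + 1 := by ring
  rw [this]
  omega

lemma vander_frob (hm : 0 < P.natDegree) :
    (Matrix.vandermonde (frobConj P)).det ^ (Fintype.card F) =
      (-1) ^ (P.natDegree + 1) * (Matrix.vandermonde (frobConj P)).det := by
  set σ := FiniteField.frobeniusAlgEquivOfAlgebraic F (AdjoinRoot P)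
  have hσ : ∀ y, σ y = y ^ (Fintype.card F) := by
    intro y; rw [FiniteField.coe_frobeniusAlgEquivOfAlgebraic]
  obtain ⟨n, hn⟩ : ∃ n, P.natDegree = n + 1 := ⟨P.natDegree - 1, by omega⟩
  have hperm : ∀ i, σ (frobConj P i) = frobConj P ((finCongr hn).symm (finRotate (n + 1) ((finCongr hn) i))) := by
    intro i
    rw [hσ, frobConj, frobConj, ← pow_mul, ← pow_succ]
    by_cases hi : (finCongr hn i) = Fin.last n
    · rw [hi, finRotate_last]
      have : (i : ℕ) = n := by simpa using congrArg Fin.val hi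
      have h0 : (((finCongr hn).symm 0 : Fin P.natDegree) : ℕ) = 0 := by simp
      rw [this, h0]
      have h1 : Fintype.card F ^ (n + 1) = Fintype.card (AdjoinRoot P) := by
        rw [adjoinRoot_card, hn]
      rw [h1, FiniteField.pow_card]
      simp
    · rw [finRotate_succ_apply]
      congr 2
      simp only [finCongr_symm, finCongr_apply, Fin.val_cast]
      rw [Fin.val_add_one]
      rw [if_neg (by simpa using hi)]
      simp
  set τ : Equiv.Perm (Fin P.natDegree) :=
    ((finCongr hn).trans (finRotate (n + 1))).trans (finCongr hn).symm with hτ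
  have hsign : Equiv.Perm.sign τ = (-1) ^ n := by
    rw [hτ, Equiv.Perm.sign_trans_trans_symm, sign_finRotate]
    simp
  rw [← hσ, ← RingHom.coe_coe (f := σ), RingHom.map_det]
  have : (σ : AdjoinRoot P →+* AdjoinRoot P).mapMatrix (Matrix.vandermonde (frobConj P)) =
      (Matrix.vandermonde (frobConj P)).submatrix τ id := by
    ext i j
    simp only [RingHom.mapMatrix_apply, Matrix.map_apply, Matrix.vandermonde_apply,
      Matrix.submatrix_apply, id, map_pow]
    rw [RingHom.coe_coe, hperm]
    rfl
  rw [this, Matrix.det_permute, hsign]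
  have h5 : (-1 : AdjoinRoot P) ^ (P.natDegree + 1) = (-1) ^ n := by
    have : P.natDegree + 1 = n + 2 := by omega
    rw [this, pow_add]; simp
  rw [h5]
  push_cast
  ring

lemma sum_card_Ioi (m : ℕ) : ∑ i : Fin m, (Finset.Ioi i).card = m.choose 2 := by
  simp_rw [Fin.card_Ioi]
  rw [Fin.sum_univ_eq_sum_range (fun i => m - 1 - i), Finset.sum_range_reflect (fun i => i),
    Finset.sum_range_id, Nat.choose_two_right]

lemma stick_irr [CharP F 3] (hm : P.Monic) :
    quadraticChar F (rs P (derivative P)) =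
      (-1) ^ (P.natDegree + 1) * quadraticChar F (-1) ^ (P.natDegree.choose 2) := by
  have := adjoinRoot_charP P
  have hpos : 0 < P.natDegree := hP.out.natDegree_pos
  set Δ := (Matrix.vandermonde (frobConj P)).det with hΔ
  have hΔ0 : Δ ≠ 0 := Matrix.det_vandermonde_ne_zero_iff.2 (frobConj_injective P)
  have hfrob := vander_frob P hpos
  rw [← hΔ] at hfrob
  have h1 : algebraMap F (AdjoinRoot P) (rs P (derivative P)) =
      (-1) ^ (P.natDegree.choose 2) * Δ ^ 2 := by
    rw [map_rs P hm, ← derivative_map, map_eq_nodal P hm]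
    have e1 : ∀ i, eval (frobConj P i) (derivative (Lagrange.nodal Finset.univ (frobConj P))) =
        ∏ j ∈ {i}ᶜ, (frobConj P i - frobConj P j) := by
      intro i
      rw [Lagrange.eval_nodal_derivative_eval_node_eq (Finset.mem_univ i), Lagrange.eval_nodal]
      congr 1
      ext j; simp
    simp_rw [e1]
    rw [← Finset.prod_prod_Ioi_mul_eq_prod_prod_off_diag
      (fun j i => frobConj P i - frobConj P j), hΔ, Matrix.det_vandermonde, ← Finset.prod_pow,
      ← sum_card_Ioi, ← Finset.prod_pow_eq_pow_sum, ← Finset.prod_mul_distrib]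
    apply Finset.prod_congr rfl
    intro i _
    rw [← Finset.prod_pow, ← Finset.prod_const, ← Finset.prod_mul_distrib]
    apply Finset.prod_congr rfl
    intro j _
    ring
  set y : F := (-1) ^ (P.natDegree.choose 2) * rs P (derivative P) with hy
  have hy2 : algebraMap F (AdjoinRoot P) y = Δ ^ 2 := by
    rw [hy, map_mul, h1, ← mul_assoc, map_pow, map_neg, map_one, ← pow_add, ← two_mul,
      pow_mul]
    simp
  obtain ⟨t, ht⟩ := card_odd F
  have hΔt : Δ ^ (2 * t) = (-1) ^ (P.natDegree + 1) := by
    apply mul_right_cancel₀ hΔ0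
    rw [← hfrob, ht, pow_succ]
  have hχy : quadraticChar F y = (-1) ^ (P.natDegree + 1) := by
    have h3 := quadraticChar_eq_pow_of_char_ne_two' (ringChar_ne_two F) y
    have h4 := congrArg (algebraMap F (AdjoinRoot P)) h3
    rw [map_pow, hy2, map_intCast, ht, ← pow_mul, show (2 * t + 1) / 2 = t by omega, hΔt] at h4
    apply Int.cast_injOn_of_ringChar_ne_two (ringChar_ne_two (AdjoinRoot P))
    · rcases quadraticChar_isQuadratic F y with h | h | h <;> rw [h] <;> simp
    · rcases neg_one_pow_eq_or ℤ (P.natDegree + 1) with h' | h' <;> rw [h'] <;> simp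
    · rw [h4]; push_cast; rfl
  have hχ1 : quadraticChar F y = quadraticChar F (-1) ^ (P.natDegree.choose 2) *
      quadraticChar F (rs P (derivative P)) := by
    rw [hy, map_mul, map_pow]
  have hsq : quadraticChar F (-1) ^ 2 = 1 := quadraticChar_sq_one (neg_ne_zero.2 one_ne_zero)
  have hsq' : (quadraticChar F (-1) ^ (P.natDegree.choose 2)) ^ 2 = 1 := by
    rw [← pow_mul, mul_comm, pow_mul, hsq, one_pow]
  rw [← hχy, hχ1]
  linear_combination (-quadraticChar F (rs P (derivative P))) * hsq'

end residueField


section pellet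
variable {F : Type} [Field F]

lemma rs_deg {f g : F[X]} (hf : f.Monic) {n : ℕ} (hn : g.natDegree ≤ n) :
    resultant f g f.natDegree n = rs f g := by
  obtain ⟨k, rfl⟩ := Nat.exists_eq_add_of_le hn
  rw [resultant_add_right_deg _ _ _ _ _ le_rfl, coeff_natDegree, hf.leadingCoeff]
  simp [rs]

lemma rs_mul_right {f : F[X]} (hf : f.Monic) (g h : F[X]) :
    rs f (g * h) = rs f g * rs f h := by
  rw [← rs_deg hf natDegree_mul_le, resultant_mul_right _ _ _ _ le_rfl]
  rfl

lemma rs_mul_left {f g : F[X]} (hf : f ≠ 0) (hg : g ≠ 0) (h : F[X]) :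
    rs (f * g) h = rs f h * rs g h := by
  rw [rs, natDegree_mul hf hg, resultant_mul_left _ _ _ _ le_rfl]
  rfl

lemma rs_add_mul {f : F[X]} (hf : f.Monic) (g p : F[X]) : rs f (g + f * p) = rs f g := by
  set n := (g + f * p).natDegree + g.natDegree + (p.natDegree + f.natDegree)
  rw [← rs_deg hf (g := g + f * p) (n := n) (by omega), ← rs_deg hf (g := g) (n := n) (by omega),
    resultant_add_mul_right _ _ _ _ _ (by omega) le_rfl]

lemma rs_one {f : F[X]} (hf : f.Monic) : rs f 1 = 1 := by
  have := rs_mul_right hf 1 1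
  simp [rs]

lemma rs_comm (f g : F[X]) : rs f g = (-1) ^ (f.natDegree * g.natDegree) * rs g f :=
  resultant_comm _ _ _ _

lemma choose_two_add (m n : ℕ) : (m + n).choose 2 = m.choose 2 + n.choose 2 + m * n := by
  induction n with
  | zero => simp
  | succ n ih =>
    rw [← add_assoc, Nat.choose_succ_succ' (m + n) 1, Nat.choose_succ_succ' n 1, ih]
    simp
    ring

variable [Fintype F] [CharP F 3]

lemma pmu_one : pmu (1 : F[X]) = 1 := by
  rw [pmu, if_pos squarefree_one]; simp

lemma pmu_irr_mul {P G : F[X]} (hP : Irreducible P) (h : Squarefree (P * G)) :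
    pmu (P * G) = - pmu G := by
  have hG : Squarefree G := h.of_mul_right
  rw [pmu, if_pos h, pmu, if_pos hG, UniqueFactorizationMonoid.normalizedFactors_mul hP.ne_zero
    hG.ne_zero, Multiset.card_add, UniqueFactorizationMonoid.normalizedFactors_irreducible hP]
  simp [pow_add]

theorem pellet_aux (n : ℕ) : ∀ f : F[X], f.Monic → Squarefree f → f.natDegree = n →
    pmu f = (-1) ^ n * quadraticChar F (-1) ^ (n.choose 2) *
      quadraticChar F (rs f (derivative f)) := by
  have hsq : quadraticChar F (-1) ^ 2 = 1 := quadraticChar_sq_one (neg_ne_zero.2 one_ne_zero)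
  set e := quadraticChar F (-1) with he
  induction n using Nat.strong_induction_on with
  | _ n ih =>
  intro f hf hsf hn
  rcases Nat.eq_zero_or_pos n with h0 | hpos
  · subst h0
    have : f = 1 := hf.natDegree_eq_zero.1 hn
    subst this
    rw [pmu_one]
    simp [rs]
  · have hnu : ¬ IsUnit f := by
      intro h
      have := natDegree_eq_zero_of_isUnit h
      omega
    obtain ⟨P, hPm, hPi, G, rfl⟩ := exists_monic_irreducible_factor f hnu
    have hG : G.Monic := hPm.of_mul_monic_left hf
    have hdeg : P.natDegree + G.natDegree = n := by
      rw [← hn, hPm.natDegree_mul hG]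
    have hPpos := hPi.natDegree_pos
    have : Fact (Irreducible P) := ⟨hPi⟩
    have hGsf : Squarefree G := hsf.of_mul_right
    have hcop : IsCoprime P G := by
      rw [hPi.coprime_iff_not_dvd]
      rintro ⟨x, rfl⟩
      have := hsf P ⟨x, by ring⟩
      exact hPi.not_isUnit this
    rw [pmu_irr_mul hPi hsf, ih G.natDegree (by omega) G hG hGsf rfl]
    have h1 : rs (P * G) (derivative (P * G)) =
        rs P (derivative P) * rs G (derivative G) *
          ((-1) ^ (P.natDegree * G.natDegree) * (rs G P) ^ 2) := by
      rw [rs_mul_left hPm.ne_zero hG.ne_zero, derivative_mul, rs_add_mul hPm, add_comm,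
        mul_comm (derivative P) G, rs_add_mul hG, rs_mul_right hPm, rs_mul_right hG, rs_comm P G]
      ring
    have h2 : rs G P ≠ 0 := resultant_ne_zero _ _ hcop.symm
    rw [h1, map_mul, map_mul, map_mul, map_pow, map_pow, quadraticChar_sq_one h2,
      stick_irr P hPm, ← he, ← hdeg, choose_two_add]
    have hs1 : ∀ k, (e ^ k) ^ 2 = 1 := by
      intro k; rw [← pow_mul, mul_comm, pow_mul, hsq, one_pow]
    have hs2 : ∀ k, ((-1 : ℤ) ^ k) ^ 2 = 1 := by
      intro k; rw [← pow_mul, mul_comm, pow_mul]; simp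
    have a1 := hs1 (P.natDegree.choose 2)
    have a2 := hs1 (P.natDegree * G.natDegree)
    have a3 := hs2 P.natDegree
    simp only [pow_add, pow_one]
    generalize (e ^ (P.natDegree.choose 2)) = x at *
    generalize (e ^ (P.natDegree * G.natDegree)) = y at *
    generalize ((-1 : ℤ) ^ P.natDegree) = z at *
    generalize ((-1 : ℤ) ^ G.natDegree) = u at *
    generalize e ^ (G.natDegree.choose 2) = v at *
    generalize quadraticChar F (rs G (derivative G)) = s at *
    have : z * u * (x * v * y) * (z * -1 * x * s * (y * 1)) = - (u * v * s) * (z ^ 2 * x ^ 2 * y ^ 2) := by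
      ring
    rw [this, a1, a2, a3]
    ring

lemma rs_prod_left {ι : Type} (s : Finset ι) (P : ι → F[X]) (hP : ∀ i, (P i).Monic) (f : F[X]) :
    rs (∏ i ∈ s, P i) f = ∏ i ∈ s, rs (P i) f := by
  rw [rs, resultant_prod_left]
  · rfl
  · exact Finset.prod_ne_zero_iff.2 fun i _ => by rw [(hP i).leadingCoeff]; exact one_ne_zero
  · exact le_rfl

lemma rs_eq_one {N f : F[X]} (hN : N.Monic) (h : N ∣ f - 1) : rs N f = 1 := by
  obtain ⟨p, hp⟩ := h
  have : f = 1 + N * p := by rw [← hp]; ring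
  rw [this, rs_add_mul hN, rs_one hN]

theorem pellet_app (n : ℕ) {ι : Type} [Fintype ι] (P : ι → F[X]) [hPi : ∀ i, Fact (Irreducible (P i))]
    (hPm : ∀ i, (P i).Monic) (N : F[X]) (hN : N.Monic) (c : F) (hc : c ≠ 0) :
    ∃ S : ℤ, (S = 1 ∨ S = -1) ∧ ∀ f : F[X], f.Monic → f.natDegree = n →
      derivative f = C c * (N * ∏ i, P i) → IsCoprime N f → rs N f = 1 →
      (∏ i, quadraticChar (AdjoinRoot (P i)) (AdjoinRoot.mk (P i) f) ≠ 0) →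
      pmu f = S * ∏ i, quadraticChar (AdjoinRoot (P i)) (AdjoinRoot.mk (P i) f) := by
  set H := C c * (N * ∏ i, P i) with hH
  have hprodm : (∏ i, P i).Monic := monic_prod_of_monic _ _ fun i _ => hPm i
  refine ⟨(-1) ^ n * quadraticChar F (-1) ^ (n.choose 2) *
    (quadraticChar F (-1) ^ (n * H.natDegree) * quadraticChar F c ^ n), ?_, ?_⟩
  · rw [← sq_eq_one_iff]
    have h1 : quadraticChar F (-1) ^ 2 = 1 := quadraticChar_sq_one (neg_ne_zero.2 one_ne_zero)
    have h2 : quadraticChar F c ^ 2 = 1 := quadraticChar_sq_one hc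
    have h3 : ∀ (x : ℤ) (k : ℕ), x ^ 2 = 1 → (x ^ k) ^ 2 = 1 := by
      intro x k hx; rw [← pow_mul, mul_comm, pow_mul, hx, one_pow]
    rw [mul_pow, mul_pow, mul_pow, h3 _ _ h1, h3 _ _ h1, h3 _ _ h2, h3 _ _ (by norm_num)]
    norm_num
  · intro f hf hn hder hcopN hrs hne
    have hcop : IsCoprime f (derivative f) := by
      rw [hder, hH]
      apply IsCoprime.mul_right
      · exact ⟨0, C c⁻¹, by rw [zero_mul, zero_add, ← C_mul, inv_mul_cancel₀ hc, C_1]⟩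
      · refine IsCoprime.mul_right hcopN.symm (IsCoprime.prod_right fun i _ => IsCoprime.symm ?_)
        rw [(Fact.out : Irreducible (P i)).coprime_iff_not_dvd]
        intro hd
        have h0 := (Finset.prod_ne_zero_iff.1 hne) i (Finset.mem_univ i)
        rw [AdjoinRoot.mk_eq_zero.2 hd] at h0
        simp at h0
    have hsf : Squarefree f := Separable.squarefree hcop
    rw [pellet_aux n f hf hsf hn, hder, rs_comm, map_mul, map_pow, hn]
    have : rs H f = c ^ n * ∏ i, rs (P i) f := by
      rw [hH, rs_mul_left (C_ne_zero.2 hc) (hN.mul hprodm).ne_zero, rs_mul_left hN.ne_zero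
        hprodm.ne_zero, hrs, rs_prod_left _ _ hPm, one_mul]
      congr 1
      rw [rs, natDegree_C, resultant_C_zero_left, hn]
    rw [this, map_mul, map_prod, map_pow]
    simp_rw [chi_rs (P _) (hPm _) f]
    ring
end pellet


/-! ### Prime counting and the choice of the derivative -/
section primes
variable {F : Type} [Field F] [Fintype F]

lemma irr_coprime {P Q : F[X]} (hP : P.Monic) (hQ : Q.Monic) (hPi : Irreducible P)
    (hQi : Irreducible Q) (h : P ≠ Q) : IsCoprime P Q := by
  rw [hPi.coprime_iff_not_dvd]
  intro hd
  exact h (eq_of_monic_of_associated hP hQ (hPi.associated_of_dvd hQi hd))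

lemma prod_irr_dvd (Z : Finset F[X]) (hZ : ∀ P ∈ Z, P.Monic ∧ Irreducible P) {A : F[X]}
    (hd : ∀ P ∈ Z, P ∣ A) : ∏ P ∈ Z, P ∣ A := by
  refine Finset.prod_dvd_of_coprime ?_ hd
  intro P hP Q hQ hPQ
  exact irr_coprime (hZ P hP).1 (hZ Q hQ).1 (hZ P hP).2 (hZ Q hQ).2 hPQ

lemma sum_irr_le (Z : Finset F[X]) (hZ : ∀ P ∈ Z, P.Monic ∧ Irreducible P) {A : F[X]} (hA : A ≠ 0)
    (hd : ∀ P ∈ Z, P ∣ A) : ∑ P ∈ Z, P.natDegree ≤ A.natDegree := by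
  have := natDegree_le_of_dvd (prod_irr_dvd Z hZ hd) hA
  rwa [natDegree_prod_of_monic _ _ fun P hP => (hZ P hP).1] at this

noncomputable def IR (F : Type) [Field F] [Fintype F] (j : ℕ) : Finset F[X] :=
  ((PL F j).image (mon j)).filter Irreducible

lemma mem_IR {j : ℕ} {P : F[X]} : P ∈ IR F j ↔ P.Monic ∧ Irreducible P ∧ P.natDegree = j := by
  rw [IR, Finset.mem_filter, Finset.mem_image]
  constructor
  · rintro ⟨⟨a, ha, rfl⟩, h⟩
    exact ⟨mon_monic ha, h, mon_natDegree ha⟩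
  · rintro ⟨h1, h2, rfl⟩
    obtain ⟨a, ha, h⟩ := exists_mon h1
    exact ⟨⟨a, ha, h.symm⟩, h2⟩

lemma IR_card {j : ℕ} (hj : 0 < j) : j * (IR F j).card ≤ Fintype.card F ^ j := by
  have hq : 1 < Fintype.card F := Fintype.one_lt_card
  have h := sum_irr_le (A := (X ^ Fintype.card F ^ j - X : F[X])) (IR F j)
    (fun P hP => ⟨(mem_IR.1 hP).1, (mem_IR.1 hP).2.1⟩)
    (FiniteField.X_pow_card_pow_sub_X_ne_zero F hj.ne' hq) ?_
  · rw [FiniteField.X_pow_card_pow_sub_X_natDegree_eq F hj.ne' hq,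
      Finset.sum_congr rfl (fun P hP => (mem_IR.1 hP).2.2), Finset.sum_const, smul_eq_mul] at h
    linarith
  · intro P hP
    have := (Irreducible.natDegree_dvd_iff_dvd_X_pow_card_pow_sub_X (mem_IR.1 hP).2.1 (n := j)).1
      (by rw [(mem_IR.1 hP).2.2])
    rwa [Nat.card_eq_fintype_card] at this

noncomputable def ISM (F : Type) [Field F] [Fintype F] (κ : ℕ) : Finset F[X] :=
  (Finset.range κ).biUnion fun i => IR F (i + 1)

lemma mem_ISM {κ : ℕ} {P : F[X]} :
    P ∈ ISM F κ ↔ P.Monic ∧ Irreducible P ∧ P.natDegree ≤ κ := by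
  simp only [ISM, Finset.mem_biUnion, Finset.mem_range, mem_IR]
  constructor
  · rintro ⟨i, hi, h1, h2, h3⟩
    exact ⟨h1, h2, by omega⟩
  · rintro ⟨h1, h2, h3⟩
    have := h2.natDegree_pos
    exact ⟨P.natDegree - 1, by omega, h1, h2, by omega⟩

lemma ISM_sum {κ : ℕ} (w : ℕ → ℕ) : ∑ P ∈ ISM F κ, w P.natDegree =
    ∑ i ∈ Finset.range κ, (IR F (i + 1)).card * w (i + 1) := by
  rw [ISM, Finset.sum_biUnion]
  · refine Finset.sum_congr rfl fun i _ => ?_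
    rw [Finset.sum_congr rfl (fun P hP => by rw [(mem_IR.1 hP).2.2]), Finset.sum_const, smul_eq_mul]
  · intro i _ j _ hij
    rw [Function.onFun, Finset.disjoint_left]
    intro P h1 h2
    have := (mem_IR.1 h1).2.2
    have := (mem_IR.1 h2).2.2
    omega

lemma ISM_sum1 (κ : ℕ) : ∑ P ∈ ISM F κ, P.natDegree * Fintype.card F ^ (κ - P.natDegree) ≤
    κ * Fintype.card F ^ κ := by
  rw [ISM_sum (fun d => d * Fintype.card F ^ (κ - d))]
  calc _ ≤ ∑ i ∈ Finset.range κ, Fintype.card F ^ κ := by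
        refine Finset.sum_le_sum fun i hi => ?_
        rw [Finset.mem_range] at hi
        have := IR_card (F := F) (Nat.succ_pos i)
        calc _ = ((i + 1) * (IR F (i + 1)).card) * Fintype.card F ^ (κ - (i + 1)) := by ring
          _ ≤ Fintype.card F ^ (i + 1) * Fintype.card F ^ (κ - (i + 1)) := by gcongr
          _ = _ := by rw [← pow_add]; congr 1; omega
    _ = _ := by simp

lemma ISM_sum2 (h3 : 3 ≤ Fintype.card F) (κ : ℕ) :
    2 * ∑ P ∈ ISM F κ, Fintype.card F ^ (2 * (κ - P.natDegree)) ≤ Fintype.card F ^ (2 * κ) := by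
  rw [ISM_sum (fun d => Fintype.card F ^ (2 * (κ - d)))]
  set q := Fintype.card F
  have h1 : ∑ i ∈ Finset.range κ, (IR F (i + 1)).card * q ^ (2 * (κ - (i + 1))) ≤
      ∑ i ∈ Finset.range κ, q ^ κ * q ^ (κ - 1 - i) := by
    refine Finset.sum_le_sum fun i hi => ?_
    rw [Finset.mem_range] at hi
    have := IR_card (F := F) (Nat.succ_pos i)
    have h' : (IR F (i + 1)).card ≤ q ^ (i + 1) := le_trans (by nlinarith) this
    calc _ ≤ q ^ (i + 1) * q ^ (2 * (κ - (i + 1))) := by gcongr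
      _ = _ := by rw [← pow_add, ← pow_add]; congr 1; omega
  rw [← Finset.mul_sum, Finset.sum_range_reflect (fun i => q ^ i)] at h1
  have h2 : (∑ i ∈ Finset.range κ, q ^ i) * 2 ≤ q ^ κ := by
    have := Nat.geomSum_eq (show 2 ≤ q by omega) κ
    have h4 : (q - 1) * (∑ i ∈ Finset.range κ, q ^ i) ≤ q ^ κ := by
      rw [this]
      exact (Nat.mul_div_le _ _).trans (Nat.sub_le _ _)
    have h5 : 2 * (∑ i ∈ Finset.range κ, q ^ i) ≤ (q - 1) * (∑ i ∈ Finset.range κ, q ^ i) :=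
      Nat.mul_le_mul_right _ (by omega)
    linarith
  calc _ ≤ 2 * (q ^ κ * ∑ i ∈ Finset.range κ, q ^ i) := by gcongr
    _ = q ^ κ * ((∑ i ∈ Finset.range κ, q ^ i) * 2) := by ring
    _ ≤ q ^ κ * q ^ κ := by gcongr
    _ = _ := by rw [← pow_add]; congr 1; omega

end primes


section choice
variable {F : Type} [Field F] [Fintype F]

lemma cnt1 {P : F[X]} (hP : P ≠ 0) (κ : ℕ) (u0 : F[X]) :
    ((PL F κ).filter fun s => P ∣ u0 + s).card ≤ Fintype.card F ^ (κ - P.natDegree) := by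
  apply residue_card hP
  intro s hs t ht
  rw [Finset.mem_filter] at hs ht
  refine ⟨?_, PL_sub hs.1 ht.1⟩
  have := dvd_sub hs.2 ht.2
  rwa [add_sub_add_left_eq_sub] at this

lemma cnt2 [CharP F 3] {P : F[X]} (hP : Irreducible P) (κ : ℕ) (u0 w : F[X]) :
    ((PL F κ).filter fun s => P ∣ (u0 + s) ^ 3 + X * w ^ 3).card ≤
      Fintype.card F ^ (κ - P.natDegree) := by
  apply residue_card hP.ne_zero
  intro s hs t ht
  rw [Finset.mem_filter] at hs ht
  refine ⟨?_, PL_sub hs.1 ht.1⟩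
  have := dvd_sub hs.2 ht.2
  have : Fact (Nat.Prime 3) := ⟨Nat.prime_three⟩
  have h3 : (u0 + s) ^ 3 + X * w ^ 3 - ((u0 + t) ^ 3 + X * w ^ 3) = (s - t) ^ 3 := by
    rw [add_sub_add_right_eq_sub, ← sub_pow_expChar (p := 3), add_sub_add_left_eq_sub]
  exact hP.prime.dvd_of_dvd_pow (h3 ▸ ‹P ∣ _ - _›)

lemma cnt3 {κ M : ℕ} {u0 v : F[X]} (hv : v ≠ 0) (hM : v.natDegree ≤ M) :
    κ * ((PL F κ).filter fun s => ∃ P : F[X], P.Monic ∧ Irreducible P ∧ κ < P.natDegree ∧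
      P ∣ u0 + s ∧ P ∣ v).card ≤ M := by
  set Z : Finset F[X] := (UniqueFactorizationMonoid.normalizedFactors v).toFinset.filter
    (fun P => κ < P.natDegree) with hZ
  have hZm : ∀ P ∈ Z, (P.Monic ∧ Irreducible P) ∧ κ < P.natDegree ∧ P ∣ v := by
    intro P hP
    rw [hZ, Finset.mem_filter, Multiset.mem_toFinset] at hP
    have hi := UniqueFactorizationMonoid.irreducible_of_normalized_factor _ hP.1
    refine ⟨⟨?_, hi⟩, hP.2,
      UniqueFactorizationMonoid.dvd_of_mem_normalizedFactors hP.1⟩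
    rw [← UniqueFactorizationMonoid.normalize_normalized_factor _ hP.1]
    exact monic_normalize hi.ne_zero
  have h1 : ((PL F κ).filter fun s => ∃ P : F[X], P.Monic ∧ Irreducible P ∧ κ < P.natDegree ∧
      P ∣ u0 + s ∧ P ∣ v) ⊆ Z.biUnion fun P => (PL F κ).filter fun s => P ∣ u0 + s := by
    intro s hs
    rw [Finset.mem_filter] at hs
    obtain ⟨hs, P, hPm, hPi, hd, h1, h2⟩ := hs
    rw [Finset.mem_biUnion]
    refine ⟨P, ?_, Finset.mem_filter.2 ⟨hs, h1⟩⟩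
    rw [hZ, Finset.mem_filter, Multiset.mem_toFinset,
      Polynomial.mem_normalizedFactors_iff hv]
    exact ⟨⟨hPi, hPm, h2⟩, hd⟩
  have h2 : ((PL F κ).filter fun s => ∃ P : F[X], P.Monic ∧ Irreducible P ∧ κ < P.natDegree ∧
      P ∣ u0 + s ∧ P ∣ v).card ≤ Z.card := by
    refine (Finset.card_le_card h1).trans (Finset.card_biUnion_le.trans ?_)
    rw [Finset.card_eq_sum_ones]
    refine Finset.sum_le_sum fun P hP => ?_
    have := cnt1 (hZm P hP).1.2.ne_zero κ u0
    rwa [Nat.sub_eq_zero_of_le (hZm P hP).2.1.le, pow_zero] at this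
  calc _ ≤ κ * Z.card := by gcongr
    _ = ∑ P ∈ Z, κ := by rw [Finset.sum_const, smul_eq_mul, mul_comm]
    _ ≤ ∑ P ∈ Z, P.natDegree := Finset.sum_le_sum fun P hP => (hZm P hP).2.1.le
    _ ≤ v.natDegree := sum_irr_le Z (fun P hP => (hZm P hP).1) hv fun P hP => (hZm P hP).2.2
    _ ≤ M := hM

theorem choose_A [CharP F 3] (h3 : 3 ≤ Fintype.card F) {κ M : ℕ} (hκ : 0 < κ) (u0 v0 : F[X])
    (hv : v0 ≠ 0) (hvκ : κ ≤ v0.natDegree) (hvM : v0.natDegree ≤ M)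
    (hM : 8 * M < κ * Fintype.card F ^ κ) :
    ∃ s ∈ PL F κ, ∃ t ∈ PL F κ, IsCoprime (u0 + s) (v0 + t) ∧
      ∑ P ∈ (ISM F κ).filter (fun P => P ∣ (u0 + s) ^ 3 + X * (v0 + t) ^ 3), P.natDegree
        ≤ 4 * κ := by
  set q := Fintype.card F with hq
  have hvt : ∀ t ∈ PL F κ, v0 + t ≠ 0 ∧ (v0 + t).natDegree ≤ M := by
    intro t ht
    have h1 : t.degree < v0.degree := by
      rw [degree_eq_natDegree hv]
      exact (mem_PL.1 ht).trans_le (by exact_mod_cast hvκ)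
    have h2 : (v0 + t).degree = v0.degree := degree_add_eq_left_of_degree_lt h1
    refine ⟨?_, by rw [natDegree_eq_natDegree h2]; exact hvM⟩
    intro h0
    rw [h0, degree_zero, degree_eq_natDegree hv] at h2
    exact absurd h2 (by simp)
  set Ω := PL F κ ×ˢ PL F κ with hΩ
  have hΩc : Ω.card = q ^ (2 * κ) := by
    rw [hΩ, Finset.card_product, card_PL, ← pow_add, two_mul]
  set B1 := Ω.filter fun x => ∃ P ∈ ISM F κ, P ∣ u0 + x.1 ∧ P ∣ v0 + x.2 with hB1
  set B2 := Ω.filter fun x => 4 * κ <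
    ∑ P ∈ (ISM F κ).filter (fun P => P ∣ (u0 + x.1) ^ 3 + X * (v0 + x.2) ^ 3), P.natDegree with hB2
  set B3 := Ω.filter fun x => ∃ P : F[X], P.Monic ∧ Irreducible P ∧ κ < P.natDegree ∧
      P ∣ u0 + x.1 ∧ P ∣ v0 + x.2 with hB3
  have c1 : 2 * B1.card ≤ q ^ (2 * κ) := by
    refine le_trans ?_ (ISM_sum2 h3 κ)
    have : B1 ⊆ (ISM F κ).biUnion fun P =>
        ((PL F κ).filter fun s => P ∣ u0 + s) ×ˢ ((PL F κ).filter fun s => P ∣ v0 + s) := by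
      intro x hx
      rw [hB1, Finset.mem_filter, hΩ, Finset.mem_product] at hx
      obtain ⟨⟨h1, h2⟩, P, hP, h4, h5⟩ := hx
      rw [Finset.mem_biUnion]
      exact ⟨P, hP, Finset.mem_product.2 ⟨Finset.mem_filter.2 ⟨h1, h4⟩,
        Finset.mem_filter.2 ⟨h2, h5⟩⟩⟩
    refine Nat.mul_le_mul_left _ ((Finset.card_le_card this).trans
      (Finset.card_biUnion_le.trans (Finset.sum_le_sum fun P hP => ?_)))
    rw [Finset.card_product, two_mul, pow_add]
    have hP0 := (mem_ISM.1 hP).2.1.ne_zero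
    exact Nat.mul_le_mul (cnt1 hP0 _ _) (cnt1 hP0 _ _)
  have c2 : 4 * B2.card ≤ q ^ (2 * κ) := by
    have e1 : B2.card * (4 * κ) ≤ ∑ x ∈ Ω, ∑ P ∈ ISM F κ,
        if P ∣ (u0 + x.1) ^ 3 + X * (v0 + x.2) ^ 3 then P.natDegree else 0 := by
      calc _ = ∑ x ∈ B2, 4 * κ := by rw [Finset.sum_const, smul_eq_mul]
        _ ≤ ∑ x ∈ B2, ∑ P ∈ ISM F κ,
            if P ∣ (u0 + x.1) ^ 3 + X * (v0 + x.2) ^ 3 then P.natDegree else 0 := by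
          refine Finset.sum_le_sum fun x hx => ?_
          rw [← Finset.sum_filter]
          exact (Finset.mem_filter.1 hx).2.le
        _ ≤ _ := Finset.sum_le_sum_of_subset (Finset.filter_subset _ _)
    have e2 : ∑ x ∈ Ω, ∑ P ∈ ISM F κ,
        (if P ∣ (u0 + x.1) ^ 3 + X * (v0 + x.2) ^ 3 then P.natDegree else 0) ≤
        ∑ P ∈ ISM F κ, q ^ κ * (P.natDegree * q ^ (κ - P.natDegree)) := by
      rw [Finset.sum_comm]
      refine Finset.sum_le_sum fun P hP => ?_
      rw [hΩ, Finset.sum_product_right, ← card_PL F κ, ← smul_eq_mul, ← Finset.sum_const]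
      refine Finset.sum_le_sum fun t _ => ?_
      rw [← Finset.sum_filter, Finset.sum_const, smul_eq_mul, mul_comm]
      exact Nat.mul_le_mul_left _ (cnt2 (mem_ISM.1 hP).2.1 _ _ _)
    rw [← Finset.mul_sum] at e2
    have e3 := Nat.mul_le_mul_left (q ^ κ) (ISM_sum1 (F := F) κ)
    have e4 : κ * (4 * B2.card) ≤ κ * q ^ (2 * κ) := by
      calc _ = B2.card * (4 * κ) := by ring
        _ ≤ _ := e1.trans (e2.trans e3)
        _ = _ := by rw [← hq]; ring
    exact Nat.le_of_mul_le_mul_left e4 hκ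
  have c3 : 8 * B3.card < q ^ (2 * κ) := by
    have e1 : κ * B3.card ≤ q ^ κ * M := by
      have : B3.card = ∑ t ∈ PL F κ, ((PL F κ).filter fun s => ∃ P : F[X], P.Monic ∧
          Irreducible P ∧ κ < P.natDegree ∧ P ∣ u0 + s ∧ P ∣ v0 + t).card := by
        rw [hB3, hΩ, Finset.card_filter, Finset.sum_product_right]
        exact Finset.sum_congr rfl fun t _ => by rw [Finset.card_filter]
      rw [this, Finset.mul_sum, ← card_PL F κ, ← smul_eq_mul, ← Finset.sum_const]
      exact Finset.sum_le_sum fun t ht => cnt3 (hvt t ht).1 (hvt t ht).2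
    have hqp : 0 < q ^ κ := pow_pos (by omega) _
    have e2 : κ * (8 * B3.card) < κ * q ^ (2 * κ) := by
      calc _ = 8 * (κ * B3.card) := by ring
        _ ≤ 8 * (q ^ κ * M) := by gcongr
        _ = q ^ κ * (8 * M) := by ring
        _ < q ^ κ * (κ * q ^ κ) := by gcongr
        _ = _ := by ring
    exact lt_of_mul_lt_mul_left e2 (Nat.zero_le _)
  have hcard : (B1 ∪ B2 ∪ B3).card < Ω.card := by
    have := Finset.card_union_le (B1 ∪ B2) B3
    have := Finset.card_union_le B1 B2
    omega
  obtain ⟨x, hx, hxn⟩ := Finset.exists_mem_notMem_of_card_lt_card hcard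
  rw [Finset.mem_union, Finset.mem_union, not_or, not_or] at hxn
  obtain ⟨⟨n1, n2⟩, n3⟩ := hxn
  rw [hB1, Finset.mem_filter, not_and] at n1
  rw [hB2, Finset.mem_filter, not_and, not_lt] at n2
  rw [hB3, Finset.mem_filter, not_and] at n3
  have n1' := n1 hx
  have n3' := n3 hx
  have hx' := Finset.mem_product.1 hx
  refine ⟨x.1, hx'.1, x.2, hx'.2, ?_, n2 hx⟩
  refine isCoprime_of_irreducible_dvd (fun h => (hvt _ hx'.2).1 h.2) ?_
  intro P hP h1 h2
  have hPm : (normalize P).Monic := monic_normalize hP.ne_zero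
  have hPa : Associated (normalize P) P := normalize_associated P
  have hPi : Irreducible (normalize P) := hPa.irreducible_iff.2 hP
  by_cases hd : (normalize P).natDegree ≤ κ
  · exact n1' ⟨normalize P, mem_ISM.2 ⟨hPm, hPi, hd⟩, hPa.dvd.trans h1, hPa.dvd.trans h2⟩
  · exact n3' ⟨normalize P, hPm, hPi, not_le.1 hd, hPa.dvd.trans h1, hPa.dvd.trans h2⟩

end choice


set_option linter.unusedSectionVars false
section assembly
variable {F : Type} [Field F] [Fintype F] [CharP F 3]

lemma cube_add (a b : F[X]) : (a + b) ^ 3 = a ^ 3 + b ^ 3 := by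
  have : Fact (Nat.Prime 3) := ⟨Nat.prime_three⟩
  exact add_pow_expChar (p := 3) a b

lemma cube_sub (a b : F[X]) : (a - b) ^ 3 = a ^ 3 - b ^ 3 := by
  have : Fact (Nat.Prime 3) := ⟨Nat.prime_three⟩
  exact sub_pow_expChar (p := 3) a b

lemma exists_cbrt (K : Type) [Field K] [Fintype K] [CharP K 3] (r : K) : ∃ s : K, s ^ 3 = r := by
  have : Fact (Nat.Prime 3) := ⟨Nat.prime_three⟩
  exact surjective_frobenius K 3 r

lemma cube_mod {W : F[X]} (hW : W.Monic) (hsq : Squarefree W) (a : F[X]) :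
    ∃ g ∈ PL F W.natDegree, W ∣ g ^ 3 - a := by
  have hmod : ∀ p : F[X], p %ₘ W ∈ PL F W.natDegree := by
    intro p
    rw [mem_PL, ← degree_eq_natDegree hW.ne_zero]
    exact degree_modByMonic_lt _ hW
  let Φ : (PL F W.natDegree) → (PL F W.natDegree) := fun g => ⟨(g.1 ^ 3) %ₘ W, hmod _⟩
  have hinj : Function.Injective Φ := by
    intro x y hxy
    have h1 : (x.1 ^ 3) %ₘ W = (y.1 ^ 3) %ₘ W := congrArg Subtype.val hxy
    have h2 : W ∣ (x.1 - y.1) ^ 3 := by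
      rw [cube_sub, ← modByMonic_eq_zero_iff_dvd hW, sub_modByMonic, h1, sub_self]
    have h3 : W ∣ x.1 - y.1 := (hsq.dvd_pow_iff_dvd (by norm_num)).1 h2
    have h4 := eq_zero_of_dvd_of_degree_lt h3 (by
      rw [degree_eq_natDegree hW.ne_zero]; exact mem_PL.1 (PL_sub x.2 y.2))
    exact Subtype.ext (sub_eq_zero.1 h4)
  obtain ⟨g, hg⟩ := Finite.surjective_of_injective hinj ⟨a %ₘ W, hmod a⟩
  refine ⟨g.1, g.2, ?_⟩
  have h1 : (g.1 ^ 3) %ₘ W = a %ₘ W := congrArg Subtype.val hg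
  rw [← modByMonic_eq_zero_iff_dvd hW, sub_modByMonic, h1, sub_self]

lemma PL_mono {m n : ℕ} (h : m ≤ n) {p : F[X]} (hp : p ∈ PL F m) : p ∈ PL F n :=
  mem_PL.2 ((mem_PL.1 hp).trans_le (by exact_mod_cast h))

lemma PL_mul {m n : ℕ} {p r : F[X]} (hp : p.natDegree ≤ m) (hr : r ∈ PL F n) :
    p * r ∈ PL F (m + n) := by
  by_cases h : p * r = 0
  · rw [h]; exact mem_PL_of_natDegree (Or.inl rfl)
  · have h2 : r ≠ 0 := right_ne_zero_of_mul h
    have := natDegree_lt_of_mem_PL hr h2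
    exact mem_PL_of_natDegree (Or.inr (natDegree_mul_le.trans_lt (by omega)))

lemma divX_PL {m : ℕ} {p : F[X]} (hp : p ∈ PL F (m + 1)) : p.divX ∈ PL F m := by
  apply mem_PL_of_natDegree
  rcases Nat.eq_zero_or_pos p.natDegree with h | h
  · left
    rw [eq_C_of_natDegree_eq_zero h, divX_C]
  · right
    have hp0 : p ≠ 0 := by rintro rfl; simp at h
    have := natDegree_lt_of_mem_PL hp hp0
    rw [natDegree_divX_eq_natDegree_tsub_one]
    omega

lemma C_mul_PL {k : ℕ} {ρ : F} {a : F[X]} (ha : a ∈ PL F k) : C ρ + X * a ∈ PL F (k + 1) := by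
  apply PL_add
  · rw [mem_PL]
    exact degree_C_le.trans_lt (by exact_mod_cast Nat.succ_pos k)
  · rw [add_comm]; exact PL_mul natDegree_X_le ha

lemma cube_decomp (k : ℕ) : ∀ p ∈ PL F (3 * k), ∃ a ∈ PL F k, ∃ b ∈ PL F k, ∃ c ∈ PL F k,
    p = a ^ 3 + X * b ^ 3 + X ^ 2 * c ^ 3 := by
  induction k with
  | zero =>
    intro p hp
    have : p = 0 := by simpa [mem_PL] using hp
    subst this
    have h0 : (0 : F[X]) ∈ PL F 0 := mem_PL_of_natDegree (Or.inl rfl)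
    exact ⟨0, h0, 0, h0, 0, h0, by simp⟩
  | succ k ih =>
    intro p hp
    have hp' : p ∈ PL F (3 * k + 1 + 1 + 1) := by
      rw [show 3 * k + 1 + 1 + 1 = 3 * (k + 1) by ring]; exact hp
    have h1 := divX_PL (divX_PL (divX_PL hp'))
    obtain ⟨a, ha, b, hb, c, hc, habc⟩ := ih _ h1
    obtain ⟨r0, hr0⟩ := exists_cbrt F (p.coeff 0)
    obtain ⟨r1, hr1⟩ := exists_cbrt F (p.divX.coeff 0)
    obtain ⟨r2, hr2⟩ := exists_cbrt F (p.divX.divX.coeff 0)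
    refine ⟨_, C_mul_PL (ρ := r0) ha, _, C_mul_PL (ρ := r1) hb, _, C_mul_PL (ρ := r2) hc, ?_⟩
    have e0 := X_mul_divX_add p
    have e1 := X_mul_divX_add p.divX
    have e2 := X_mul_divX_add p.divX.divX
    rw [habc, ← hr2] at e2
    rw [← e2, ← hr1] at e1
    rw [← e1, ← hr0] at e0
    rw [cube_add, cube_add, cube_add, ← e0]
    simp only [C_pow]
    ring

lemma deriv_cube (g : F[X]) : derivative (g ^ 3) = 0 := by
  have h3 : (3 : F[X]) = 0 := by
    have := CharP.cast_eq_zero F[X] 3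
    exact_mod_cast this
  rw [derivative_pow]
  simp only [Nat.cast_ofNat, map_ofNat, h3]
  ring

lemma deriv_A (u v : F[X]) : derivative (u ^ 3 + X * v ^ 3) = v ^ 3 := by
  rw [derivative_add, derivative_mul, deriv_cube, deriv_cube, derivative_X]
  ring

lemma deriv_F (b : ℕ) (w u v g : F[X]) :
    derivative (X ^ (3 * b) * (w ^ 3 + X * u ^ 3 - X ^ 2 * v ^ 3) + g ^ 3) =
      X ^ (3 * b) * (u ^ 3 + X * v ^ 3) := by
  have h3 : (3 : F[X]) = 0 := by
    have := CharP.cast_eq_zero F[X] 3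
    exact_mod_cast this
  have hX : (X ^ (3 * b) : F[X]) = (X ^ b) ^ 3 := by rw [← pow_mul, mul_comm]
  rw [hX, pow_two X]
  simp only [derivative_add, derivative_sub, derivative_mul, deriv_cube, derivative_X]
  linear_combination (-(X ^ b) ^ 3 * X * v ^ 3) * h3

lemma sqfree_A {u v : F[X]} (h : IsCoprime u v) : Squarefree (u ^ 3 + X * v ^ 3) := by
  apply Separable.squarefree
  rw [Separable, deriv_A]
  have : IsCoprime (u ^ 3) (v ^ 3) := h.pow
  exact this.add_mul_right_left X

lemma coprime_of_dvd_sub_one {N f : F[X]} (h : N ∣ f - 1) : IsCoprime N f := by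
  obtain ⟨p, hp⟩ := h
  exact ⟨-p, 1, by linear_combination hp⟩

end assembly


set_option linter.unusedSectionVars false
section core
variable {F : Type} [Field F] [Fintype F] [CharP F 3]

lemma sqfree_factor {A : F[X]} (hA : Squarefree A) :
    ∃ Z : Finset F[X], (∀ P, P ∈ Z ↔ Irreducible P ∧ P.Monic ∧ P ∣ A) ∧
      A = C A.leadingCoeff * ∏ P ∈ Z, P := by
  have hA0 : A ≠ 0 := hA.ne_zero
  refine ⟨(UniqueFactorizationMonoid.normalizedFactors A).toFinset, ?_, ?_⟩
  · intro P
    rw [Multiset.mem_toFinset, Polynomial.mem_normalizedFactors_iff hA0]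
  · have hnd := (UniqueFactorizationMonoid.squarefree_iff_nodup_normalizedFactors hA0).1 hA
    have h1 : ∏ P ∈ (UniqueFactorizationMonoid.normalizedFactors A).toFinset, P =
        (UniqueFactorizationMonoid.normalizedFactors A).prod := by
      rw [Finset.prod_eq_multiset_prod, Multiset.toFinset_val, hnd.dedup, Multiset.map_id']
    rw [h1]
    exact (Polynomial.leadingCoeff_mul_prod_normalizedFactors A).symm

lemma chi_cube {K : Type} [Field K] [Fintype K] (x : K) :
    quadraticChar K (x ^ 3) = quadraticChar K x := by
  rw [map_pow]
  rcases quadraticChar_isQuadratic K x with h | h | h <;> rw [h] <;> norm_num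

theorem core (a0 : ℕ) (ha0 : 0 < a0) (hF : Fintype.card F = 3 ^ a0) (N0 : ℕ) :
    ∃ κ0 : ℕ, ∀ κ ≥ κ0, 0 < κ → ∀ (b a n : ℕ) (w u v : F[X]), IsCoprime u v →
      ∑ P ∈ (ISM F κ).filter (fun P => P ∣ u ^ 3 + X * v ^ 3), P.natDegree ≤ 4 * κ →
      (u ^ 3 + X * v ^ 3).natDegree ≤ a → a ≤ N0 * κ →
      10 * κ + 1 ≤ (u ^ 3 + X * v ^ 3).natDegree →
      (X ^ (3 * b) * (w ^ 3 + X * u ^ 3 - X ^ 2 * v ^ 3)).Monic →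
      (X ^ (3 * b) * (w ^ 3 + X * u ^ 3 - X ^ 2 * v ^ 3)).natDegree = n →
      3 * (6 * κ + 1 + a / 4) ≤ n → ∀ ε : ℤ, (ε = 1 ∨ ε = -1) →
      ∃ G ∈ PL F (6 * κ + 1 + a / 4),
        pmu (X ^ (3 * b) * (w ^ 3 + X * u ^ 3 - X ^ 2 * v ^ 3) + G ^ 3) = ε := by
  obtain ⟨κ0, hκ0⟩ := thmB a0 ha0 hF N0
  refine ⟨κ0, ?_⟩
  intro κ hκ hκpos b a n w u v huv hsmall hAa haN hA10 hΦm hΦn h3n ε hε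
  set A := u ^ 3 + X * v ^ 3 with hA
  set Φ := X ^ (3 * b) * (w ^ 3 + X * u ^ 3 - X ^ 2 * v ^ 3) with hΦ
  have hAsq : Squarefree A := sqfree_A huv
  have hA0 : A ≠ 0 := hAsq.ne_zero
  obtain ⟨Z, hZ, hAZ⟩ := sqfree_factor hAsq
  set Zs := Z.filter (fun P => P.natDegree ≤ κ) with hZs
  set L := Z.filter (fun P => ¬ P.natDegree ≤ κ) with hL
  have hZsm : ∀ P ∈ Zs, P.Monic ∧ Irreducible P ∧ P ∣ A ∧ P.natDegree ≤ κ := by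
    intro P hP
    obtain ⟨h1, h2⟩ := Finset.mem_filter.1 hP
    obtain ⟨h3, h4, h5⟩ := (hZ P).1 h1
    exact ⟨h4, h3, h5, h2⟩
  have hLm : ∀ P ∈ L, P.Monic ∧ Irreducible P ∧ P ∣ A ∧ κ < P.natDegree := by
    intro P hP
    obtain ⟨h1, h2⟩ := Finset.mem_filter.1 hP
    obtain ⟨h3, h4, h5⟩ := (hZ P).1 h1
    exact ⟨h4, h3, h5, not_le.1 h2⟩
  have hsplit : (∏ P ∈ Zs, P) * ∏ P ∈ L, P = ∏ P ∈ Z, P := Finset.prod_filter_mul_prod_filter_not _ _ _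
  set As := ∏ P ∈ Zs, P with hAs
  have hAsm : As.Monic := monic_prod_of_monic _ _ fun P hP => (hZsm P hP).1
  have hLpm : (∏ P ∈ L, P).Monic := monic_prod_of_monic _ _ fun P hP => (hLm P hP).1
  have hAsd : As.natDegree ≤ 4 * κ := by
    rw [hAs, natDegree_prod_of_monic _ _ fun P hP => (hZsm P hP).1]
    refine le_trans (Finset.sum_le_sum_of_subset ?_) hsmall
    intro P hP
    obtain ⟨h1, h2, h3, h4⟩ := hZsm P hP
    exact Finset.mem_filter.2 ⟨mem_ISM.2 ⟨h1, h2, h4⟩, h3⟩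
  have hlc : A.leadingCoeff ≠ 0 := leadingCoeff_ne_zero.2 hA0
  have hAdeg : A.natDegree = As.natDegree + (∏ P ∈ L, P).natDegree := by
    rw [← natDegree_mul hAsm.ne_zero hLpm.ne_zero, hsplit]
    conv_lhs => rw [hAZ]
    rw [natDegree_C_mul hlc]
  set d := ∑ i : L, (i.1).natDegree with hd
  have hdL : (∏ P ∈ L, P).natDegree = d := by
    rw [natDegree_prod_of_monic _ _ fun P hP => (hLm P hP).1, hd]
    exact (Finset.sum_coe_sort L (fun P => P.natDegree)).symm
  -- the modulus
  set V := insert (X : F[X]) Zs with hV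
  have hVm : ∀ P ∈ V, P.Monic ∧ Irreducible P ∧ P.natDegree ≤ κ := by
    intro P hP
    rcases Finset.mem_insert.1 hP with rfl | h
    · exact ⟨monic_X, irreducible_X, by rw [natDegree_X]; omega⟩
    · exact ⟨(hZsm P h).1, (hZsm P h).2.1, (hZsm P h).2.2.2⟩
  set W := ∏ P ∈ V, P with hW
  have hWm : W.Monic := monic_prod_of_monic _ _ fun P hP => (hVm P hP).1
  have hWd : W.natDegree ≤ 4 * κ + 1 := by
    rw [hW, natDegree_prod_of_monic _ _ fun P hP => (hVm P hP).1]
    rw [hAs, natDegree_prod_of_monic _ _ fun P hP => (hZsm P hP).1] at hAsd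
    by_cases hX : X ∈ Zs
    · rw [hV, Finset.insert_eq_of_mem hX]; omega
    · rw [hV, Finset.sum_insert hX, natDegree_X]; omega
  have hWsq : Squarefree W := by
    rw [hW]
    refine Finset.squarefree_prod_of_pairwise_isCoprime ?_ fun P hP => (hVm P hP).2.1.squarefree
    intro P hP Q hQ hPQ
    exact (irr_coprime (hVm P hP).1 (hVm Q hQ).1 (hVm P hP).2.1 (hVm Q hQ).2.1 hPQ).isRelPrime
  have hXW : X ∣ W := Finset.dvd_prod_of_mem _ (Finset.mem_insert_self _ _)
  have hAsW : As ∣ W := Finset.prod_dvd_prod_of_subset _ _ _ (Finset.subset_insert _ _)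
  obtain ⟨g0, hg0, hg0d⟩ := cube_mod hWm hWsq (1 - Φ)
  have hW1 : ∀ g : F[X], W ∣ Φ + (g0 + W * g) ^ 3 - 1 := by
    intro g
    rw [cube_add]
    have : Φ + (g0 ^ 3 + (W * g) ^ 3) - 1 = (g0 ^ 3 - (1 - Φ)) + W * (W ^ 2 * g ^ 3) := by ring
    rw [this]
    exact dvd_add hg0d (dvd_mul_right _ _)
  -- fields
  have hfact : ∀ i : L, Fact (Irreducible i.1) := fun i => ⟨(hLm i.1 i.2).2.1⟩
  have hchar : ∀ i : L, CharP (AdjoinRoot i.1) 3 := fun i => adjoinRoot_charP i.1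
  have hcb : ∀ i : L, ∃ ω : AdjoinRoot i.1, ω ^ 3 = AdjoinRoot.mk i.1 Φ := fun i =>
    exists_cbrt _ _
  choose ω hω using hcb
  have hWi : ∀ i : L, AdjoinRoot.mk i.1 W ≠ 0 := by
    intro i h0
    rw [AdjoinRoot.mk_eq_zero, hW, (hLm i.1 i.2).2.1.prime.dvd_finsetProd_iff] at h0
    obtain ⟨P, hP, hdvd⟩ := h0
    have h1 := natDegree_le_of_dvd hdvd (hVm P hP).1.ne_zero
    have h2 := (hVm P hP).2.2
    have h3 := (hLm i.1 i.2).2.2.2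
    omega
  set w' : ∀ i : L, AdjoinRoot i.1 := fun i =>
    (ω i + AdjoinRoot.mk i.1 g0) / AdjoinRoot.mk i.1 W with hw'
  have hchi : ∀ (i : L) (g : F[X]), quadraticChar (AdjoinRoot i.1)
      (AdjoinRoot.mk i.1 (Φ + (g0 + W * g) ^ 3)) =
      quadraticChar (AdjoinRoot i.1) (AdjoinRoot.mk i.1 W) *
        quadraticChar (AdjoinRoot i.1) (w' i + AdjoinRoot.mk i.1 g) := by
    intro i g
    have : Fact (Nat.Prime 3) := ⟨Nat.prime_three⟩
    rw [← map_mul, ← chi_cube (_ * _)]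
    congr 1
    have e : AdjoinRoot.mk i.1 W * (w' i + AdjoinRoot.mk i.1 g) =
        ω i + AdjoinRoot.mk i.1 (g0 + W * g) := by
      rw [hw', mul_add, mul_div_cancel₀ _ (hWi i), map_add, map_mul, add_assoc]
    rw [e, add_pow_expChar (p := 3) (ω i), hω, map_add, map_pow]
  obtain ⟨S, hS, hpel⟩ := pellet_app n (fun i : L => i.1) (fun i => (hLm i.1 i.2).1)
    (X ^ (3 * b) * As) ((monic_X_pow _).mul hAsm) A.leadingCoeff hlc
  set τ := ∏ i : L, quadraticChar (AdjoinRoot i.1) (AdjoinRoot.mk i.1 W) with hτ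
  have hτ2 : τ * τ = 1 := by
    rw [hτ, ← Finset.prod_mul_distrib]
    refine Finset.prod_eq_one fun i _ => ?_
    rw [← pow_two, quadraticChar_sq_one (hWi i)]
  have hS2 : S * S = 1 := by rcases hS with h | h <;> rw [h] <;> norm_num
  have hε2 : ε * ε = 1 := by rcases hε with h | h <;> rw [h] <;> norm_num
  obtain ⟨g, hg, hgprod⟩ := hκ0 κ hκ L (fun i => AdjoinRoot i.1) (fun i => AdjoinRoot.mk i.1)
    (fun i => i.1) (fun i p => AdjoinRoot.mk_eq_zero) (fun i => adjoinRoot_card i.1)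
    (fun i => (hLm i.1 i.2).2.2.2) d hd (by omega) (by omega)
    (by
      intro p hp hp0
      rw [hd, Finset.sum_coe_sort L (fun P => P.natDegree)]
      refine sum_irr_le L (fun P hP => ⟨(hLm P hP).1, (hLm P hP).2.1⟩) hp0 fun P hP => ?_
      exact AdjoinRoot.mk_eq_zero.1 (hp ⟨P, hP⟩))
    w' (S * τ * ε) (Int.isUnit_iff.1 (IsUnit.of_mul_eq_one (S * τ * ε) (by
      linear_combination (τ * τ * (ε * ε)) * hS2 + ε * ε * hτ2 + hε2)))
  have hGPL : g0 + W * g ∈ PL F (6 * κ + 1 + a / 4) := by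
    have hd4 : d / 4 ≤ a / 4 := Nat.div_le_div_right (by omega)
    refine PL_add (PL_mono (by omega) hg0) (PL_mono ?_ (PL_mul hWd hg))
    omega
  refine ⟨g0 + W * g, hGPL, ?_⟩
  have hprod : ∏ i : L, quadraticChar (AdjoinRoot i.1)
      (AdjoinRoot.mk i.1 (Φ + (g0 + W * g) ^ 3)) = τ * (S * τ * ε) := by
    rw [Finset.prod_congr rfl fun i _ => hchi i g, Finset.prod_mul_distrib, hgprod]
  have hGdeg : ((g0 + W * g) ^ 3).degree < Φ.degree := by
    rw [degree_eq_natDegree hΦm.ne_zero, hΦn]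
    by_cases h0 : g0 + W * g = 0
    · rw [h0]; simp
    · have h1 := natDegree_lt_of_mem_PL hGPL h0
      refine degree_le_natDegree.trans_lt ?_
      rw [natDegree_pow]
      exact_mod_cast (by omega : 3 * (g0 + W * g).natDegree < n)
  have hfm : (Φ + (g0 + W * g) ^ 3).Monic := hΦm.add_of_left hGdeg
  have hfn : (Φ + (g0 + W * g) ^ 3).natDegree = n := by
    rw [natDegree_add_eq_left_of_degree_lt hGdeg, hΦn]
  have hAs1 : As ∣ Φ + (g0 + W * g) ^ 3 - 1 := hAsW.trans (hW1 g)
  have hX1 : X ∣ Φ + (g0 + W * g) ^ 3 - 1 := hXW.trans (hW1 g)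
  rw [hpel _ hfm hfn ?_ ?_ ?_ ?_]
  · rw [hprod]
    linear_combination (τ * τ * ε) * hS2 + ε * hτ2
  · rw [hΦ, deriv_F, ← hA]
    conv_lhs => rw [hAZ, ← hsplit]
    rw [Finset.prod_coe_sort L (fun P => P)]
    ring
  · exact ((coprime_of_dvd_sub_one hX1).pow_left).mul_left (coprime_of_dvd_sub_one hAs1)
  · rw [rs_mul_left (monic_X_pow _).ne_zero hAsm.ne_zero, rs_eq_one hAsm hAs1, mul_one]
    have := rs_prod_left (Finset.range (3 * b)) (fun _ => (X : F[X])) (fun _ => monic_X)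
      (Φ + (g0 + W * g) ^ 3)
    rw [Finset.prod_const, Finset.prod_const, rs_eq_one monic_X hX1, one_pow,
      Finset.card_range] at this
    exact this
  · rw [hprod]
    intro h0
    have : (τ * (S * τ * ε)) * (τ * (S * τ * ε)) = 1 := by
      linear_combination (τ * τ * (τ * τ) * (ε * ε)) * hS2 + (τ * τ + 1) * (ε * ε) * hτ2 + hε2
    rw [h0] at this
    norm_num at this
end core


set_option linter.unusedSectionVars false
section final
variable {F : Type} [Field F] [Fintype F] [CharP F 3]

lemma natDegree_le_of_mem_PL {k : ℕ} {p : F[X]} (h : p ∈ PL F (k + 1)) : p.natDegree ≤ k := by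
  by_cases h0 : p = 0
  · rw [h0]; simp
  · exact Nat.lt_succ_iff.1 (natDegree_lt_of_mem_PL h h0)

theorem short (a0 : ℕ) (ha0 : 0 < a0) (hF : Fintype.card F = 3 ^ a0) (N1 : ℕ) (hN1 : 100 ≤ N1) :
    ∃ D : ℕ, ∀ f : F[X], f.Monic → D ≤ f.natDegree → ∀ ε : ℤ, (ε = 1 ∨ ε = -1) →
      ∃ g : F[X], g.natDegree ≤ 3 * (f.natDegree / 7) + 18 * (f.natDegree / N1) + 20 ∧
        pmu (f + g) = ε := by
  obtain ⟨κ0, hcore⟩ := core a0 ha0 hF (2 * N1)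
  refine ⟨N1 * (κ0 + 16 * N1 + 1), ?_⟩
  intro f hf hD ε hε
  set n := f.natDegree with hn
  set κ := n / N1 with hκ
  have hκ1 : κ0 + 16 * N1 + 1 ≤ κ := by
    rw [hκ, Nat.le_div_iff_mul_le (by omega)]; linarith
  have hκ2 : 100 * κ ≤ n := by
    have := Nat.mul_div_le n N1
    rw [← hκ] at this
    nlinarith
  have hκ3 : n ≤ 2 * N1 * κ := by
    have h1 := Nat.lt_mul_div_succ n (show 0 < N1 by omega)
    rw [← hκ] at h1
    nlinarith
  have hq3 : 3 ≤ Fintype.card F := by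
    rw [hF]
    calc 3 = 3 ^ 1 := by norm_num
      _ ≤ 3 ^ a0 := Nat.pow_le_pow_right (by norm_num) ha0
  set b := n / 7 + 1 with hb
  set m := n - 3 * b with hm
  obtain ⟨k, hk⟩ : ∃ k, k = m / 3 := ⟨_, rfl⟩
  have hXm : (X ^ (3 * b) : F[X]).Monic := monic_X_pow _
  set f1 := f /ₘ X ^ (3 * b) with hf1
  have hfdec : f %ₘ X ^ (3 * b) + X ^ (3 * b) * f1 = f := modByMonic_add_div f _
  have hf1d : f1.natDegree = m := by
    rw [hf1, natDegree_divByMonic f hXm, natDegree_X_pow]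
  have hf1m : f1.Monic := by
    rw [Monic, hf1, leadingCoeff_divByMonic_of_monic hXm]
    · exact hf
    · rw [degree_X_pow, degree_eq_natDegree hf.ne_zero]
      exact_mod_cast (by omega : 3 * b ≤ n)
  obtain ⟨w0, hw0, u0, hu0, z, hz, hdec⟩ := cube_decomp (k + 1) f1
    (mem_PL_of_natDegree (Or.inr (by omega)))
  set v0 := -z with hv0
  have hv0P : v0 ∈ PL F (k + 1) := by
    rw [mem_PL, hv0, degree_neg]; exact mem_PL.1 hz
  have hdec' : f1 = w0 ^ 3 + X * u0 ^ 3 - X ^ 2 * v0 ^ 3 := by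
    rw [hdec, hv0]; ring
  obtain ⟨v00, h1, h2, h3⟩ : ∃ v00 : F[X], 4 * κ ≤ v00.natDegree ∧ v00 - v0 ∈ PL F (4 * κ + 1) ∧
      v00 ∈ PL F (k + 1) := by
    by_cases h : 4 * κ ≤ v0.natDegree
    · exact ⟨v0, h, by rw [sub_self]; exact mem_PL_of_natDegree (Or.inl rfl), hv0P⟩
    · have hX : ∀ j, 4 * κ < j → (X ^ (4 * κ) : F[X]) ∈ PL F j := fun j hj =>
        mem_PL_of_natDegree (Or.inr (by rw [natDegree_X_pow]; exact hj))
      refine ⟨X ^ (4 * κ), by rw [natDegree_X_pow], PL_sub (hX _ (by omega)) ?_, hX _ (by omega)⟩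
      exact mem_PL_of_natDegree (Or.inr (by omega))
  have hv00 : v00 ≠ 0 := by
    rintro rfl
    rw [natDegree_zero] at h1
    omega
  have h3' := natDegree_le_of_mem_PL h3
  have hMq : 8 * n < κ * Fintype.card F ^ κ := by
    have e1 : 16 * N1 < Fintype.card F ^ κ :=
      lt_of_lt_of_le (by omega) (Nat.lt_pow_self (show 1 < Fintype.card F by omega)).le
    calc 8 * n ≤ 8 * (2 * N1 * κ) := by gcongr
      _ = κ * (16 * N1) := by ring
      _ < _ := Nat.mul_lt_mul_of_pos_left e1 (by omega)
  obtain ⟨s, hs, t, ht, hcop, hsm⟩ := choose_A hq3 (M := n) (show 0 < κ by omega) u0 v00 hv00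
    (by omega) (by omega) hMq
  set u := u0 + s with hu
  set v := v00 + t with hv
  have hud : u.natDegree ≤ k := natDegree_le_of_mem_PL (PL_add hu0 (PL_mono (by omega) hs))
  have hvd : v.natDegree ≤ k := natDegree_le_of_mem_PL (PL_add h3 (PL_mono (by omega) ht))
  have hvd2 : 4 * κ ≤ v.natDegree := by
    rw [hv, natDegree_add_eq_left_of_degree_lt]
    · exact h1
    · rw [degree_eq_natDegree hv00]
      exact (mem_PL.1 ht).trans_le (by exact_mod_cast (by omega : κ ≤ v00.natDegree))
  have hA1 : (u ^ 3 + X * v ^ 3).natDegree ≤ 3 * k + 1 := by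
    refine natDegree_add_le_of_degree_le ?_ ?_
    · rw [natDegree_pow]; omega
    · refine natDegree_mul_le.trans ?_
      rw [natDegree_pow, natDegree_X]; omega
  have hA2 : 10 * κ + 1 ≤ (u ^ 3 + X * v ^ 3).natDegree := by
    have e1 := natDegree_derivative_le (u ^ 3 + X * v ^ 3)
    rw [deriv_A, natDegree_pow] at e1
    omega
  set E := X * s ^ 3 - X ^ 2 * (v - v0) ^ 3 with hE
  have hf1E : w0 ^ 3 + X * u ^ 3 - X ^ 2 * v ^ 3 = f1 + E := by
    rw [hE, hdec', hu, cube_add, cube_sub]; ring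
  have hEd : E.natDegree ≤ 12 * κ + 2 := by
    have e1 : s.natDegree ≤ 4 * κ := natDegree_le_of_mem_PL (PL_mono (by omega) hs)
    have e2 : (v - v0).natDegree ≤ 4 * κ := by
      apply natDegree_le_of_mem_PL
      have : v - v0 = (v00 - v0) + t := by rw [hv]; ring
      rw [this]
      exact PL_add h2 (PL_mono (by omega) ht)
    refine (natDegree_sub_le _ _).trans (max_le ?_ ?_)
    · refine natDegree_mul_le.trans ?_
      rw [natDegree_pow, natDegree_X]; omega
    · refine natDegree_mul_le.trans ?_
      rw [natDegree_pow, natDegree_pow, natDegree_X]; omega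
  have hEdeg : E.degree < f1.degree := by
    rw [degree_eq_natDegree hf1m.ne_zero, hf1d]
    refine degree_le_natDegree.trans_lt ?_
    exact_mod_cast (by omega : E.natDegree < m)
  have hm1 : (f1 + E).Monic := hf1m.add_of_left hEdeg
  obtain ⟨G, hG, hmu⟩ := hcore κ (by omega) (by omega) b (3 * k + 1) n w0 u v hcop hsm hA1
    (by omega) hA2 (by rw [hf1E]; exact hXm.mul hm1)
    (by
      rw [hf1E, hXm.natDegree_mul hm1, natDegree_X_pow,
        natDegree_add_eq_left_of_degree_lt hEdeg, hf1d]
      omega)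
    (by omega) ε hε
  refine ⟨X ^ (3 * b) * E + G ^ 3 - f %ₘ X ^ (3 * b), ?_, ?_⟩
  · have e1 : (f %ₘ X ^ (3 * b)).natDegree ≤ 3 * b := by
      have := natDegree_modByMonic_le f hXm
      rwa [natDegree_X_pow] at this
    have e2 : G.natDegree ≤ 6 * κ + (3 * k + 1) / 4 :=
      natDegree_le_of_mem_PL (PL_mono (by omega) hG)
    refine (natDegree_sub_le _ _).trans (max_le ?_ (by omega))
    refine natDegree_add_le_of_degree_le ?_ ?_
    · refine natDegree_mul_le.trans ?_
      rw [natDegree_X_pow]; omega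
    · rw [natDegree_pow]; omega
  · rw [hf1E] at hmu
    rw [← hmu]
    congr 1
    linear_combination -hfdec
end final

/-- **Sign changes of Möbius in short intervals in characteristic 3.** Let `q` be a power of `3`
and fix `3/7 < η < 1`. Then for every monic `f` of large enough degree there are `g, h` with
`|g|, |h| ≤ |f|^η` such that `μ(f + g) = 1` and `μ(f + h) = −1`. -/
theorem statement7 (q : ℕ) (hq : ∃ n : ℕ, 1 ≤ n ∧ q = 3 ^ n)
    (η : ℝ) (hη1 : 3 / 7 < η) (hη2 : η < 1)
    (Fq : Type) [Field Fq] [Fintype Fq] (hcard : Fintype.card Fq = q) :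
    ∃ D : ℕ, ∀ f : Polynomial Fq, f.Monic → D ≤ f.natDegree →
      (∃ g : Polynomial Fq, pnorm g ≤ (pnorm f) ^ η ∧ pmu (f + g) = 1) ∧
      (∃ h : Polynomial Fq, pnorm h ≤ (pnorm f) ^ η ∧ pmu (f + h) = -1) := by
  obtain ⟨a0, ha0, rfl⟩ := hq
  have hfact : Fact (Nat.Prime 3) := ⟨Nat.prime_three⟩
  have hchar : CharP Fq 3 := charP_of_card_eq_prime_pow (f := a0) hcard
  have hδ : 0 < η - 3 / 7 := by linarith
  obtain ⟨N1, hN1⟩ := exists_nat_gt (max 100 (36 / (η - 3 / 7)))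
  have hN100 : (100 : ℝ) < N1 := (le_max_left _ _).trans_lt hN1
  have hN36 : 36 / (η - 3 / 7) < N1 := (le_max_right _ _).trans_lt hN1
  obtain ⟨D, hD⟩ := short (F := Fq) a0 ha0 hcard N1 (by exact_mod_cast hN100.le)
  obtain ⟨D', hD'⟩ := exists_nat_gt (40 / (η - 3 / 7))
  refine ⟨max D D', ?_⟩
  intro f hf hfD
  have key : ∀ ε : ℤ, (ε = 1 ∨ ε = -1) →
      ∃ g : Fq[X], pnorm g ≤ (pnorm f) ^ η ∧ pmu (f + g) = ε := by
    intro ε hε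
    obtain ⟨g, hg, hmu⟩ := hD f hf ((le_max_left _ _).trans hfD) ε hε
    refine ⟨g, ?_, hmu⟩
    set n := f.natDegree with hn
    have hq1 : (1 : ℝ) ≤ (Fintype.card Fq : ℝ) := by
      exact_mod_cast Fintype.card_pos
    have hnD : (D' : ℝ) ≤ n := by exact_mod_cast (le_max_right _ _).trans hfD
    have hgr : (g.natDegree : ℝ) ≤ η * n := by
      have e1 : (g.natDegree : ℝ) ≤ 3 * ((n / 7 : ℕ) : ℝ) + 18 * ((n / N1 : ℕ) : ℝ) + 20 := by
        exact_mod_cast hg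
      have e2 : ((n / 7 : ℕ) : ℝ) ≤ (n : ℝ) / 7 := by exact_mod_cast Nat.cast_div_le (α := ℝ)
      have e3 : ((n / N1 : ℕ) : ℝ) ≤ (n : ℝ) / N1 := Nat.cast_div_le
      have e4 : 18 * ((n : ℝ) / N1) ≤ (η - 3 / 7) / 2 * n := by
        rw [div_lt_iff₀ hδ] at hN36
        rw [mul_div_assoc', div_le_iff₀ (by linarith)]
        have : (0 : ℝ) ≤ n := Nat.cast_nonneg n
        nlinarith
      have e5 : 20 ≤ (η - 3 / 7) / 2 * n := by
        have := hD'.le.trans hnD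
        rw [div_le_iff₀ hδ] at this
        linarith
      linarith
    have hpf : pnorm f = (Fintype.card Fq : ℝ) ^ n := by
      rw [pnorm, if_neg hf.ne_zero]
    have hpg : pnorm g ≤ (Fintype.card Fq : ℝ) ^ g.natDegree := by
      rw [pnorm]
      split_ifs
      · positivity
      · exact le_rfl
    rw [hpf, ← Real.rpow_natCast, ← Real.rpow_mul (by linarith)]
    refine hpg.trans ?_
    rw [← Real.rpow_natCast]
    exact Real.rpow_le_rpow_of_exponent_le hq1 (by linarith)
  exact ⟨key 1 (Or.inl rfl), key (-1) (Or.inr rfl)⟩
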